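/- arXiv:2009.11998 — 3 statements merged into one kernel-verified Lean document; each statement's English description precedes it below -/
import Mathlib

section
/- For every integer k ≥ 5, every prime power q with q ≥ k−2, and every integer d satisfying (k−3)q^{k−1} − 3q^{k−2} + q^{k−3} − q² + q ≤ d ≤ (k−3)q^{k−1} − 3q^{k−2} + q^{k−3}, there exists an [g_q(k,d), k, d]_q linear code, i.e., a code attaining the Griesmer bound. -/
/-- `C` is an `[n, k, d]_q` linear code over `F`: a `k`-dimensional `F`-linear subspace of
`F^n` such that the minimum Hamming weight of a nonzero codeword equals `d`. -/
def IsLinearCodeWith (F : Type) [Field F] [DecidableEq F] (n k d : ℕ)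
    (C : Submodule F (Fin n → F)) : Prop :=
  Module.finrank F C = k ∧
  (∀ c ∈ C, c ≠ 0 → d ≤ hammingNorm c) ∧
  (∃ c ∈ C, c ≠ 0 ∧ hammingNorm c = d)

/-- The Griesmer function `g_q(k, d) = ∑_{i=0}^{k-1} ⌈d / q^i⌉`. -/
def griesmer (q k d : ℕ) : ℕ := ∑ i ∈ Finset.range k, (d + q ^ i - 1) / q ^ i


open scoped LinearAlgebra.Projectivization

theorem aux_sum_proj (F : Type) [Field F] [Fintype F] [DecidableEq F] (V : Type) [AddCommGroup V]
    [Module F V] [Fintype V] [DecidableEq V] [Fintype (ℙ F V)] (g : V → ℕ)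
    (hg : ∀ (c : F) (v : V), c ≠ 0 → g (c • v) = g v) :
    ∑ v : {v : V // v ≠ 0}, g v = (Fintype.card F - 1) * ∑ p : ℙ F V, g p.rep := by
  have hb : Function.Bijective (fun x : ℙ F V × Fˣ =>
      (⟨x.2 • x.1.rep, by
        rw [Units.smul_def]; exact smul_ne_zero x.2.ne_zero x.1.rep_nonzero⟩ : {v : V // v ≠ 0})) := by
    constructor
    · rintro ⟨p, u⟩ ⟨p', u'⟩ h
      have h1 : u • p.rep = u' • p'.rep := congrArg Subtype.val h
      have hp : p = p' := by
        rw [← p.mk_rep, ← p'.mk_rep, Projectivization.mk_eq_mk_iff]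
        exact ⟨u⁻¹ * u', by rw [mul_smul, ← h1, inv_smul_smul]⟩
      subst hp
      have : u = u' := by
        ext
        exact smul_left_injective F p.rep_nonzero h1
      rw [this]
    · rintro ⟨v, hv⟩
      obtain ⟨a, ha⟩ := Projectivization.exists_smul_eq_mk_rep F v hv
      exact ⟨(Projectivization.mk F v hv, a⁻¹), by
        apply Subtype.ext
        simp [← ha]⟩
  rw [← hb.sum_comp (fun v : {v : V // v ≠ 0} => g v), Fintype.sum_prod_type, Finset.mul_sum]
  apply Finset.sum_congr rfl
  intro p _
  have : ∀ u : Fˣ, g (u • p.rep) = g p.rep := fun u => hg u p.rep u.ne_zero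
  simp only [this, Finset.sum_const, Finset.card_univ, Fintype.card_units, smul_eq_mul]

theorem aux_code (F : Type) [Field F] [Fintype F] [DecidableEq F] (V : Type) [AddCommGroup V]
    [Module F V] [Fintype V] [DecidableEq V] (k n d : ℕ) (hk : Module.finrank F V = k)
    (m : V → ℕ) (hm : ∀ (c : F) (v : V), c ≠ 0 → m (c • v) = m v) (hd : 0 < d)
    (hn : (Fintype.card F - 1) * n = ∑ v : V, if v ≠ 0 then m v else 0)
    (hlow : ∀ φ : Module.Dual F V, φ ≠ 0 →
      (Fintype.card F - 1) * d ≤ ∑ v : V, if φ v ≠ 0 then m v else 0)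
    (φ₀ : Module.Dual F V) (hφ₀ : φ₀ ≠ 0)
    (heq : (Fintype.card F - 1) * d = ∑ v : V, if φ₀ v ≠ 0 then m v else 0) :
    ∃ C : Submodule F (Fin n → F), IsLinearCodeWith F n k d C := by
  classical
  have : Fintype (ℙ F V) := Fintype.ofFinite _
  have hq : 0 < Fintype.card F - 1 := by
    have := Fintype.one_lt_card (α := F); omega
  have key : ∀ (P : V → Prop) [DecidablePred P], (∀ (c : F) (v : V), c ≠ 0 → (P (c • v) ↔ P v)) → ¬ P 0 →
      ∑ v : V, (if P v then m v else 0) =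
        (Fintype.card F - 1) * ∑ p : ℙ F V, if P p.rep then m p.rep else 0 := by
    intro P _ hP h0
    rw [← aux_sum_proj F V (fun v => if P v then m v else 0)]
    · rw [← Finset.sum_subtype (s := Finset.univ.filter (fun v : V => v ≠ 0)) (by simp)
        (fun v => if P v then m v else 0)]
      · rw [Finset.sum_filter]
        apply Finset.sum_congr rfl
        intro v _
        by_cases hv : v = 0
        · subst hv; simp [h0]
        · simp [hv]
    · intro c v hc
      simp only [hP c v hc, hm c v hc]
  let ι := Σ p : ℙ F V, Fin (m p.rep)
  have hcard : Fintype.card ι = n := by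
    have h := key (fun v => v ≠ 0) (by intro c v hc; simp [hc]) (by simp)
    rw [← hn] at h
    have h2 := Nat.eq_of_mul_eq_mul_left hq h
    rw [h2]
    simp [ι, Projectivization.rep_nonzero]
  let e : Fin n ≃ ι := (Fintype.equivFinOfCardEq hcard).symm
  let L : Module.Dual F V →ₗ[F] (Fin n → F) :=
    LinearMap.pi (fun i => LinearMap.applyₗ ((e i).1.rep))
  have hL : ∀ φ i, L φ i = φ (e i).1.rep := fun φ i => rfl
  have hw : ∀ φ : Module.Dual F V, (Fintype.card F - 1) * hammingNorm (L φ) =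
      ∑ v : V, if φ v ≠ 0 then m v else 0 := by
    intro φ
    rw [key (fun v => φ v ≠ 0) (by intro c v hc; simp [hc]) (by simp)]
    congr 1
    unfold hammingNorm
    simp only [hL]
    rw [Finset.card_filter, e.sum_comp (fun x : ι => if φ x.1.rep ≠ 0 then 1 else 0),
      Fintype.sum_sigma]
    apply Finset.sum_congr rfl
    intro p _
    split_ifs <;> simp
  have hinj : Function.Injective L := by
    rw [← LinearMap.ker_eq_bot, LinearMap.ker_eq_bot']
    intro φ h
    by_contra hne
    have h1 := hlow φ hne
    rw [← hw, h] at h1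
    have := Nat.le_of_mul_le_mul_left h1 hq
    simp at this
    omega
  refine ⟨LinearMap.range L, ?_, ?_, ?_⟩
  · rw [LinearMap.finrank_range_of_inj hinj, Subspace.dual_finrank_eq, hk]
  · rintro _ ⟨φ, rfl⟩ hne
    have h1 := hlow φ (by rintro rfl; simp at hne)
    rw [← hw] at h1
    exact Nat.le_of_mul_le_mul_left h1 hq
  · refine ⟨L φ₀, ⟨φ₀, rfl⟩, ?_, ?_⟩
    · intro h
      exact hφ₀ (hinj (by rw [h, map_zero]))
    · rw [← hw] at heq
      exact (Nat.eq_of_mul_eq_mul_left hq heq).symm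

/-- Griesmer sum via floors of the deficit. -/
theorem aux_griesmer (q k s d E : ℕ) (hq : 0 < q) (hk : 0 < k) (h : d + E = s * q ^ (k - 1)) :
    griesmer q k d + ∑ i ∈ Finset.range k, E / q ^ i = ∑ i ∈ Finset.range k, s * q ^ (k - 1 - i) := by
  unfold griesmer
  rw [← Finset.sum_add_distrib]
  apply Finset.sum_congr rfl
  intro i hi
  rw [Finset.mem_range] at hi
  have hQ : 0 < q ^ i := Nat.pow_pos hq
  have e1 : q ^ (k - 1) = q ^ i * q ^ (k - 1 - i) := by rw [← pow_add]; congr 1; omega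
  rw [e1] at h
  generalize q ^ (k - 1 - i) = W at *
  generalize q ^ i = Q at *
  have h1 := Nat.div_add_mod E Q
  have h2 := Nat.mod_lt E hQ
  generalize E / Q = a at *
  generalize E % Q = r at *
  have h3 : Q * a ≤ Q * (s * W) := by
    have : s * (Q * W) = Q * (s * W) := by ring
    omega
  have h4 := Nat.le_of_mul_le_mul_left h3 hQ
  obtain ⟨c, hc⟩ := Nat.exists_eq_add_of_le h4
  have h5 : d + Q - 1 = Q * c + (Q - 1 - r) := by
    have : s * (Q * W) = Q * a + Q * c := by rw [← mul_add, ← hc]; ring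
    omega
  rw [h5, Nat.mul_add_div hQ, Nat.div_eq_of_lt (by omega), hc]
  omega

theorem aux_floor_succ (q m E : ℕ) :
    ∑ i ∈ Finset.range (m + 1), E / q ^ i = E + ∑ i ∈ Finset.range m, (E / q) / q ^ i := by
  rw [Finset.sum_range_succ', add_comm]
  simp [pow_succ', Nat.div_div_eq_div_mul]

theorem aux_floor_base (q j : ℕ) (hq : 3 ≤ q) :
    ((q : ℤ) - 1) * ((∑ i ∈ Finset.range (j + 3), (2 * q ^ (j + 1) + (q - 1) * q ^ j) / q ^ i : ℕ) : ℤ)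
      = 2 * ((q : ℤ) ^ (j + 2) - 1) + ((q : ℤ) - 1) * ((q : ℤ) ^ (j + 1) - 1) := by
  induction j with
  | zero =>
    rw [aux_floor_succ, aux_floor_succ, aux_floor_succ]
    have e1 : (2 * q ^ (0 + 1) + (q - 1) * q ^ 0) / q = 2 := by
      rw [Nat.div_eq_iff (by omega)]; simp; omega
    rw [e1, Nat.div_eq_of_lt (show 2 < q by omega)]
    obtain ⟨r, rfl⟩ := Nat.exists_eq_add_of_le hq
    have : 3 + r - 1 = r + 2 := by omega
    rw [this]
    simp
    ring
  | succ j ih =>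
    rw [aux_floor_succ]
    have e1 : (2 * q ^ (j + 1 + 1) + (q - 1) * q ^ (j + 1)) / q = 2 * q ^ (j + 1) + (q - 1) * q ^ j := by
      have : 2 * q ^ (j + 1 + 1) + (q - 1) * q ^ (j + 1) =
        (2 * q ^ (j + 1) + (q - 1) * q ^ j) * q := by ring
      rw [this, Nat.mul_div_cancel _ (by omega)]
    rw [e1, Nat.cast_add, mul_add, ih]
    obtain ⟨r, rfl⟩ := Nat.exists_eq_add_of_le hq
    have : 3 + r - 1 = r + 2 := by omega
    rw [this]
    push_cast
    ring

theorem aux_floor (q j t b : ℕ) (hq : 3 ≤ q) (ht : t < q) (hb : b < q) :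
    ((q : ℤ) - 1) * ((∑ i ∈ Finset.range (j + 5),
        (2 * q ^ (j + 3) + (q - 1) * q ^ (j + 2) + t * q + b) / q ^ i : ℕ) : ℤ)
      = 2 * ((q : ℤ) ^ (j + 4) - 1) + ((q : ℤ) - 1) * ((q : ℤ) ^ (j + 3) - 1)
        + t * ((q : ℤ) ^ 2 - 1) + b * ((q : ℤ) - 1) := by
  rw [aux_floor_succ, aux_floor_succ]
  have e1 : (2 * q ^ (j + 3) + (q - 1) * q ^ (j + 2) + t * q + b) / q
      = 2 * q ^ (j + 2) + (q - 1) * q ^ (j + 1) + t := by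
    have : 2 * q ^ (j + 3) + (q - 1) * q ^ (j + 2) + t * q + b =
        q * (2 * q ^ (j + 2) + (q - 1) * q ^ (j + 1) + t) + b := by ring
    rw [this, Nat.mul_add_div (by omega), Nat.div_eq_of_lt hb, add_zero]
  have e2 : (2 * q ^ (j + 2) + (q - 1) * q ^ (j + 1) + t) / q
      = 2 * q ^ (j + 1) + (q - 1) * q ^ j := by
    have : 2 * q ^ (j + 2) + (q - 1) * q ^ (j + 1) + t =
        q * (2 * q ^ (j + 1) + (q - 1) * q ^ j) + t := by ring
    rw [this, Nat.mul_add_div (by omega), Nat.div_eq_of_lt ht, add_zero]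
  rw [e1, e2]
  have := aux_floor_base q j hq
  generalize ∑ i ∈ Finset.range (j + 3), (2 * q ^ (j + 1) + (q - 1) * q ^ j) / q ^ i = S at *
  rw [Nat.cast_add, Nat.cast_add _ S, mul_add, mul_add, this]
  obtain ⟨r, rfl⟩ := Nat.exists_eq_add_of_le hq
  have : 3 + r - 1 = r + 2 := by omega
  rw [this]
  push_cast
  ring

theorem aux_geom (q k s : ℕ) :
    ((q : ℤ) - 1) * ((∑ i ∈ Finset.range k, s * q ^ (k - 1 - i) : ℕ) : ℤ) = s * ((q : ℤ) ^ k - 1) := by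
  rw [← Finset.mul_sum, Finset.sum_range_reflect (fun i => q ^ i)]
  push_cast
  rw [← mul_geom_sum]
  ring

open Polynomial in
/-- The ambient space: pairs of a polynomial of degree `< j+3` and a linear polynomial `b + c x`. -/
abbrev AuxV (F : Type) [Field F] (j : ℕ) : Type := (Polynomial.degreeLT F (j + 3)) × F × F

section cnt
variable {F : Type} [Field F] [Fintype F] {V : Type} [AddCommGroup V] [Module F V] [Fintype V]

open Classical in
/-- Number of vectors of `U` satisfying `P`. -/
noncomputable def auxN (P : V → Prop) (U : Submodule F V) : ℤ :=
  ∑ v : V, if P v then (if v ∈ U then 1 else 0) else 0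

theorem auxN_zero (φ : Module.Dual F V) (U : Submodule F V) (h : ∀ v ∈ U, φ v = 0) :
    auxN (fun v => φ v ≠ 0) U = 0 := by
  unfold auxN
  apply Finset.sum_eq_zero
  intro v _
  split_ifs with h1 h2
  · exact absurd (h v h2) h1
  · rfl
  · rfl

theorem aux_card (U : Submodule F V) (u : ℕ) (hu : Module.finrank F U = u) :
    auxN (fun _ => True) U = (Fintype.card F : ℤ) ^ u := by
  classical
  unfold auxN
  simp only [if_true]
  rw [Finset.sum_boole, ← hu, ← Fintype.card_subtype]
  have := Module.card_eq_pow_finrank (K := F) (V := U)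
  rw [← Nat.card_eq_fintype_card] at this ⊢
  exact_mod_cast this

theorem auxN_nonzero (U : Submodule F V) (u : ℕ) (hu : Module.finrank F U = u) :
    auxN (fun v => v ≠ 0) U = (Fintype.card F : ℤ) ^ u - 1 := by
  classical
  rw [← aux_card U u hu]
  unfold auxN
  have : ∑ v : V, (if v = 0 then (1 : ℤ) else 0) = 1 := by simp
  rw [eq_sub_iff_add_eq, ← this, ← Finset.sum_add_distrib]
  apply Finset.sum_congr rfl
  intro v _
  by_cases hv : v = 0
  · subst hv; simp
  · simp [hv]

theorem auxN_full (φ : Module.Dual F V) (U : Submodule F V) (u : ℕ)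
    (hu : Module.finrank F U = u + 1) (h : ∃ v ∈ U, φ v ≠ 0) :
    auxN (fun v => φ v ≠ 0) U = (Fintype.card F : ℤ) ^ (u + 1) - (Fintype.card F : ℤ) ^ u := by
  classical
  have hk : Module.finrank F (U ⊓ LinearMap.ker φ : Submodule F V) = u := by
    let ψ : U →ₗ[F] F := φ.domRestrict U
    have hr : LinearMap.range ψ = ⊤ := by
      obtain ⟨v, hv, hne⟩ := h
      apply LinearMap.range_eq_top.2
      apply LinearMap.surjective
      intro h0
      exact hne (by simpa [ψ] using LinearMap.congr_fun h0 ⟨v, hv⟩)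
    have h1 := LinearMap.finrank_range_add_finrank_ker ψ
    rw [hr, finrank_top, Module.finrank_self, hu] at h1
    have h2 : (U ⊓ LinearMap.ker φ : Submodule F V) = (LinearMap.ker ψ).map U.subtype := by
      ext v
      simp [ψ, Submodule.mem_map, and_comm]
    rw [h2, Submodule.finrank_map_subtype_eq]
    omega
  rw [← aux_card U _ hu, ← aux_card _ _ hk]
  unfold auxN
  rw [eq_sub_iff_add_eq, ← Finset.sum_add_distrib]
  apply Finset.sum_congr rfl
  intro v _
  by_cases h1 : v ∈ U <;> by_cases h2 : φ v = 0 <;> simp [h1, h2]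

theorem auxN_le (φ : Module.Dual F V) (U : Submodule F V) (u : ℕ)
    (hu : Module.finrank F U = u + 1) :
    auxN (fun v => φ v ≠ 0) U ≤ (Fintype.card F : ℤ) ^ (u + 1) - (Fintype.card F : ℤ) ^ u := by
  by_cases h : ∃ v ∈ U, φ v ≠ 0
  · exact (auxN_full φ U u hu h).le
  · rw [auxN_zero φ U (by push Not at h; exact h), sub_nonneg]
    apply pow_le_pow_right₀
    · exact_mod_cast Fintype.card_pos
    · omega

open Classical in
/-- The multiplicity function before clipping. -/
noncomputable def auxG (s : ℤ) (S₁ S₂ U' : Submodule F V) (U : F → Submodule F V)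
    (L P : F → Submodule F V) (T Q : Finset F) (v : V) : ℤ :=
  s - (if v ∈ S₁ then 1 else 0) - (if v ∈ S₂ then 1 else 0) - (∑ x : F, if v ∈ U x then 1 else 0)
    + (if v ∈ U' then 1 else 0) - (∑ t ∈ T, if v ∈ L t then 1 else 0)
    - (∑ t ∈ Q, if v ∈ P t then 1 else 0)

open Classical in
theorem auxG_sum (s : ℤ) (S₁ S₂ U' : Submodule F V) (U : F → Submodule F V)
    (L P : F → Submodule F V) (T Q : Finset F) (p : V → Prop) :
    ∑ v : V, (if p v then auxG s S₁ S₂ U' U L P T Q v else 0) =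
      s * auxN p (⊤ : Submodule F V) - auxN p S₁ - auxN p S₂ - (∑ x : F, auxN p (U x)) + auxN p U'
        - (∑ t ∈ T, auxN p (L t)) - (∑ t ∈ Q, auxN p (P t)) := by
  unfold auxN
  rw [Finset.mul_sum, Finset.sum_comm (s := (Finset.univ : Finset F)),
    Finset.sum_comm (s := T), Finset.sum_comm (s := Q)]
  rw [← Finset.sum_sub_distrib, ← Finset.sum_sub_distrib, ← Finset.sum_sub_distrib,
    ← Finset.sum_add_distrib, ← Finset.sum_sub_distrib, ← Finset.sum_sub_distrib]
  apply Finset.sum_congr rfl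
  intro v _
  unfold auxG
  by_cases h : p v <;> simp [h]

theorem auxG_smul (s : ℤ) (S₁ S₂ U' : Submodule F V) (U : F → Submodule F V)
    (L P : F → Submodule F V) (T Q : Finset F) (c : F) (v : V) (hc : c ≠ 0) :
    auxG s S₁ S₂ U' U L P T Q (c • v) = auxG s S₁ S₂ U' U L P T Q v := by
  unfold auxG
  have h : ∀ W : Submodule F V, c • v ∈ W ↔ v ∈ W := fun W => W.smul_mem_iff hc
  classical
  simp only [h]

end cnt

section geom
open Polynomial
variable (F : Type) [Field F] (j : ℕ)

noncomputable def auxA (p : F[X]) (hp : p.natDegree < j + 3) : degreeLT F (j + 3) :=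
  ⟨p, mem_degreeLT.2 (lt_of_le_of_lt degree_le_natDegree (by exact_mod_cast hp))⟩

noncomputable def auxc : AuxV F j →ₗ[F] F := (LinearMap.snd F F F).comp (LinearMap.snd F _ (F × F))
noncomputable def auxb : AuxV F j →ₗ[F] F := (LinearMap.fst F F F).comp (LinearMap.snd F _ (F × F))
noncomputable def auxpoly : AuxV F j →ₗ[F] F[X] := (degreeLT F (j + 3)).subtype.comp (LinearMap.fst F _ (F × F))
noncomputable def auxco (i : ℕ) : AuxV F j →ₗ[F] F := (lcoeff F i).comp (auxpoly F j)
noncomputable def auxS1 : Submodule F (AuxV F j) := LinearMap.ker (auxc F j)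
noncomputable def auxS2 : Submodule F (AuxV F j) := LinearMap.ker (auxco F j (j + 2))
noncomputable def auxU' : Submodule F (AuxV F j) := LinearMap.ker (LinearMap.snd F _ (F × F))
noncomputable def auxUm (x : F) : AuxV F j →ₗ[F] F × F :=
  LinearMap.prod ((leval x).comp (auxpoly F j)) (auxb F j + x • auxc F j)
noncomputable def auxU (x : F) : Submodule F (AuxV F j) := LinearMap.ker (auxUm F j x)
noncomputable def auxg1 (t : F) : AuxV F j := (auxA F j (X ^ (j + 2)) (by simp), t, 0)
noncomputable def auxg2 (t : F) : AuxV F j := (auxA F j (C t) (by simp), 0, 1)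
noncomputable def auxL (t : F) : Submodule F (AuxV F j) := Submodule.span F {auxg1 F j t, auxg2 F j t}
noncomputable def auxP (t β : F) : Submodule F (AuxV F j) := Submodule.span F {auxg1 F j t + β • auxg2 F j t}
noncomputable def auxphi : Module.Dual F (AuxV F j) := auxco F j 1 + auxb F j

variable {F j}

theorem mem_auxS1 (v : AuxV F j) : v ∈ auxS1 F j ↔ v.2.2 = 0 := Iff.rfl
theorem mem_auxS2 (v : AuxV F j) : v ∈ auxS2 F j ↔ v.1.1.coeff (j + 2) = 0 := Iff.rfl
theorem mem_auxU' (v : AuxV F j) : v ∈ auxU' F j ↔ v.2.1 = 0 ∧ v.2.2 = 0 := by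
  simp [auxU', Prod.ext_iff]
theorem mem_auxU (x : F) (v : AuxV F j) :
    v ∈ auxU F j x ↔ v.1.1.eval x = 0 ∧ v.2.1 + x * v.2.2 = 0 := by
  simp [auxU, auxUm, auxpoly, auxb, auxc]
theorem mem_auxL (t : F) (v : AuxV F j) :
    v ∈ auxL F j t ↔ ∃ α β : F, v.1.1 = C α * X ^ (j + 2) + C (β * t) ∧ v.2.1 = α * t ∧ v.2.2 = β := by
  rw [auxL, Submodule.mem_span_pair]
  apply exists_congr; intro α
  apply exists_congr; intro β
  constructor
  · rintro rfl
    simp [auxg1, auxg2, auxA, smul_eq_C_mul]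
  · rintro ⟨h1, h2, h3⟩
    refine Prod.ext (Subtype.ext ?_) (Prod.ext ?_ ?_)
    · rw [h1]; simp [auxg1, auxg2, auxA, smul_eq_C_mul]
    · rw [h2]; simp [auxg1, auxg2]
    · rw [h3]; simp [auxg1, auxg2]
theorem mem_auxP (t β : F) (v : AuxV F j) :
    v ∈ auxP F j t β → ∃ α : F, v.1.1 = C α * X ^ (j + 2) + C (α * β * t) ∧ v.2.1 = α * t ∧ v.2.2 = α * β := by
  rw [auxP, Submodule.mem_span_singleton]
  rintro ⟨α, rfl⟩
  exact ⟨α, by simp [auxg1, auxg2, auxA, smul_eq_C_mul, mul_add, mul_assoc],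
    by simp [auxg1, auxg2], by simp [auxg1, auxg2]⟩

theorem finrank_auxV : Module.finrank F (AuxV F j) = j + 5 := by
  have : Module.finrank F (degreeLT F (j + 3)) = j + 3 := by
    rw [(degreeLTEquiv F (j + 3)).finrank_eq]; simp
  rw [Module.finrank_prod, this]; simp

instance : FiniteDimensional F (degreeLT F (j + 3)) :=
  Module.Finite.equiv (degreeLTEquiv F (j + 3)).symm

theorem finrank_ker_aux {W : Type} [AddCommGroup W] [Module F W] 
    (f : AuxV F j →ₗ[F] W) (hf : Function.Surjective f) (w u : ℕ)
    (hW : Module.finrank F W = w) (h : w + u = j + 5) : Module.finrank F (LinearMap.ker f) = u := by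
  have h1 := LinearMap.finrank_range_add_finrank_ker f
  rw [LinearMap.range_eq_top.2 hf, finrank_top, finrank_auxV, hW] at h1
  omega

theorem finrank_auxS1 : Module.finrank F (auxS1 F j) = j + 3 + 1 :=
  finrank_ker_aux _ (fun c => ⟨(0, 0, c), rfl⟩) 1 _ (Module.finrank_self F) (by omega)
theorem finrank_auxS2 : Module.finrank F (auxS2 F j) = j + 3 + 1 :=
  finrank_ker_aux _ (fun c => ⟨(auxA F j (C c * X ^ (j + 2))
    (lt_of_le_of_lt (natDegree_C_mul_X_pow_le _ _) (by omega)), 0, 0), by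
      simp [auxco, auxpoly, auxA]⟩) 1 _ (Module.finrank_self F) (by omega)
theorem finrank_auxU' : Module.finrank F (auxU' F j) = j + 2 + 1 :=
  finrank_ker_aux _ (fun c => ⟨(0, c), rfl⟩) 2 _ (by simp) (by omega)
theorem finrank_auxU (x : F) : Module.finrank F (auxU F j x) = j + 2 + 1 :=
  finrank_ker_aux _ (fun c => ⟨(auxA F j (C c.1) (by simp), c.2, 0), by
    simp [auxUm, auxpoly, auxA, auxb, auxc]⟩) 2 _ (by simp) (by omega)
theorem finrank_auxL (t : F) : Module.finrank F (auxL F j t) = 1 + 1 := by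
  have hli : LinearIndependent F ![auxg1 F j t, auxg2 F j t] := by
    rw [LinearIndependent.pair_iff]
    intro a b h
    have hb : b = 0 := by
      have := congrArg (fun v : AuxV F j => v.2.2) h
      simpa [auxg1, auxg2] using this
    have ha : a = 0 := by
      have := congrArg (fun v : AuxV F j => v.1.1.coeff (j + 2)) h
      simpa [auxg1, auxg2, auxA, coeff_C] using this
    exact ⟨ha, hb⟩
  have := finrank_span_eq_card hli
  have h2 : Set.range ![auxg1 F j t, auxg2 F j t] = {auxg1 F j t, auxg2 F j t} := by
    simp only [Matrix.range_cons, Matrix.range_empty, Set.union_empty]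
    rfl
  rw [h2] at this
  exact this.trans (by simp)
theorem finrank_auxP (t β : F) : Module.finrank F (auxP F j t β) = 0 + 1 := by
  apply finrank_span_singleton
  intro h
  have := congrArg (fun v : AuxV F j => v.1.1.coeff (j + 2)) h
  simp [auxg1, auxg2, auxA, coeff_C] at this

end geom

section pos
open Polynomial
variable {F : Type} [Field F] [Fintype F] {j : ℕ}

open Classical in
theorem aux_sumU_c (v : AuxV F j) (hc : v.2.2 ≠ 0) :
    (∑ x : F, if v ∈ auxU F j x then (1 : ℤ) else 0) =
      if v.1.1.eval (-v.2.1 / v.2.2) = 0 then 1 else 0 := by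
  rw [Finset.sum_eq_single (-v.2.1 / v.2.2)]
  · simp only [mem_auxU]
    have : v.2.1 + -v.2.1 / v.2.2 * v.2.2 = 0 := by field_simp; ring
    simp [this]
  · intro x _ hx
    rw [if_neg]
    rw [mem_auxU]
    rintro ⟨_, h⟩
    apply hx
    field_simp
    linear_combination h
  · simp

open Classical in
theorem aux_sumU_b (v : AuxV F j) (hc : v.2.2 = 0) (hb : v.2.1 ≠ 0) :
    (∑ x : F, if v ∈ auxU F j x then (1 : ℤ) else 0) = 0 := by
  apply Finset.sum_eq_zero
  intro x _
  rw [if_neg]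
  rw [mem_auxU]
  rintro ⟨_, h⟩
  simp [hc, hb] at h

open Classical in
theorem aux_sumU_a (v : AuxV F j) (h0 : v.1.1 ≠ 0) :
    (∑ x : F, if v ∈ auxU F j x then (1 : ℤ) else 0) ≤ v.1.1.natDegree := by
  rw [Finset.sum_boole]
  have h1 : (Finset.univ.filter (fun x : F => v ∈ auxU F j x)) ⊆ v.1.1.roots.toFinset := by
    intro x hx
    simp only [Finset.mem_filter, mem_auxU] at hx
    simp [h0, hx.2.1]
  have h2 := Finset.card_le_card h1
  have h3 := Multiset.toFinset_card_le v.1.1.roots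
  have h4 := card_roots' v.1.1
  exact_mod_cast h2.trans (h3.trans h4)

theorem aux_natDegree (v : AuxV F j) : v.1.1.natDegree ≤ j + 2 := by
  have h := mem_degreeLT.1 v.1.2
  by_cases h0 : v.1.1 = 0
  · rw [h0]; simp
  · rw [degree_eq_natDegree h0] at h
    have : v.1.1.natDegree < j + 3 := by exact_mod_cast h
    omega

open Classical in
/-- base multiplicity -/
noncomputable def auxG0 (v : AuxV F j) : ℤ :=
  ((j : ℤ) + 2) - (if v ∈ auxS1 F j then 1 else 0) - (if v ∈ auxS2 F j then 1 else 0)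
    - (∑ x : F, if v ∈ auxU F j x then 1 else 0) + (if v ∈ auxU' F j then 1 else 0)

theorem auxG0_nonneg (v : AuxV F j) (hv : v ≠ 0) : 0 ≤ auxG0 v := by
  classical
  unfold auxG0
  by_cases hc : v.2.2 = 0
  · by_cases hb : v.2.1 = 0
    · have h0 : v.1.1 ≠ 0 := by
        intro h
        exact hv (Prod.ext (Subtype.ext h) (Prod.ext hb hc))
      have h1 := aux_sumU_a v h0
      have h2 := aux_natDegree v
      simp only [mem_auxS1, mem_auxS2, mem_auxU', hb, hc, and_self, if_true]
      split_ifs with h3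
      · have : v.1.1.natDegree ≠ j + 2 := by
          intro h
          rw [← h] at h3
          exact h0 (leadingCoeff_eq_zero.1 h3)
        omega
      · omega
    · rw [aux_sumU_b v hc hb]
      simp only [mem_auxS1, mem_auxS2, mem_auxU', hb, hc]
      split_ifs <;> simp_all <;> omega
  · rw [aux_sumU_c v hc]
    simp only [mem_auxS1, mem_auxS2, mem_auxU', hc]
    split_ifs <;> simp_all <;> omega

theorem auxG0_pos (v : AuxV F j) (hv : v ≠ 0) (t : F) (ht : t ≠ 0) (hL : v ∈ auxL F j t) :
    1 ≤ auxG0 v := by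
  classical
  obtain ⟨α, β, h1, h2, h3⟩ := (mem_auxL t v).1 hL
  have hR : v.1.1.coeff (j + 2) = α := by rw [h1]; simp [coeff_C]
  unfold auxG0
  by_cases hc : v.2.2 = 0
  · have hβ : β = 0 := by rw [← h3, hc]
    have hα : α ≠ 0 := by
      rintro rfl
      apply hv
      exact Prod.ext (Subtype.ext (by rw [h1, hβ]; simp)) (Prod.ext (by rw [h2]; simp) hc)
    have hb : v.2.1 ≠ 0 := by rw [h2]; exact mul_ne_zero hα ht
    rw [aux_sumU_b v hc hb]
    simp only [mem_auxS1, mem_auxS2, mem_auxU', hb, hc, hR, hα]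
    simp
    omega
  · rw [aux_sumU_c v hc]
    by_cases hα : α = 0
    · have : v.1.1.eval (-v.2.1 / v.2.2) ≠ 0 := by
        rw [h1, hα]
        simp only [map_zero, zero_mul, zero_add, eval_C]
        rw [← h3]
        exact mul_ne_zero hc ht
      simp only [mem_auxS1, mem_auxS2, mem_auxU', hc, hR, hα, this]
      simp
      omega
    · simp only [mem_auxS1, mem_auxS2, mem_auxU', hc, hR, hα]
      split_ifs <;> simp_all <;> omega

theorem auxL_disj (v : AuxV F j) (hv : v ≠ 0) (s t : F) (hs : v ∈ auxL F j s)
    (ht : v ∈ auxL F j t) : s = t := by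
  obtain ⟨α, β, h1, h2, h3⟩ := (mem_auxL s v).1 hs
  obtain ⟨α', β', h1', h2', h3'⟩ := (mem_auxL t v).1 ht
  have hR : v.1.1.coeff (j + 2) = α := by rw [h1]; simp [coeff_C]
  have hR' : v.1.1.coeff (j + 2) = α' := by rw [h1']; simp [coeff_C]
  have hz : v.1.1.coeff 0 = β * s := by rw [h1]; simp
  have hz' : v.1.1.coeff 0 = β' * t := by rw [h1']; simp
  have ha : α = α' := by rw [← hR, hR']
  have hb : β = β' := by rw [← h3, h3']
  subst ha hb
  by_cases h : α = 0
  · by_cases h' : β = 0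
    · exfalso
      apply hv
      exact Prod.ext (Subtype.ext (by rw [h1, h, h']; simp)) (Prod.ext (by rw [h2, h]; simp) (by rw [h3, h']; rfl))
    · exact mul_left_cancel₀ h' (hz.symm.trans hz')
  · exact mul_left_cancel₀ h (h2.symm.trans h2')

theorem auxP_le (t β : F) (v : AuxV F j) (h : v ∈ auxP F j t β) : v ∈ auxL F j t := by
  obtain ⟨α, h1, h2, h3⟩ := mem_auxP t β v h
  exact (mem_auxL t v).2 ⟨α, α * β, h1, h2, h3⟩

theorem auxP_disj (v : AuxV F j) (hv : v ≠ 0) (t β β' : F) (h : v ∈ auxP F j t β)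
    (h' : v ∈ auxP F j t β') : β = β' := by
  obtain ⟨α, h1, h2, h3⟩ := mem_auxP t β v h
  obtain ⟨α', h1', h2', h3'⟩ := mem_auxP t β' v h'
  have hR : v.1.1.coeff (j + 2) = α := by rw [h1]; simp [coeff_C]
  have hR' : v.1.1.coeff (j + 2) = α' := by rw [h1']; simp [coeff_C]
  have ha : α = α' := by rw [← hR, hR']
  subst ha
  by_cases h : α = 0
  · exfalso
    apply hv
    exact Prod.ext (Subtype.ext (by rw [h1, h]; simp)) (Prod.ext (by rw [h2, h]; simp) (by rw [h3, h]; simp))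
  · exact mul_left_cancel₀ h (h3.symm.trans h3')

open Classical in
theorem aux_boole_le_one (T : Finset F) (p : F → Prop) (h : ∀ s t, p s → p t → s = t) :
    (∑ t ∈ T, if p t then (1 : ℤ) else 0) ≤ 1 := by
  rw [Finset.sum_boole]
  have : (T.filter p).card ≤ 1 := by
    rw [Finset.card_le_one]
    intro a ha b hb
    exact h a b (Finset.mem_filter.1 ha).2 (Finset.mem_filter.1 hb).2
  exact_mod_cast this

theorem auxG_nonneg (T Q : Finset F) (t₀ : F) (hT : ∀ t ∈ T, t ≠ 0)
    (hQ : ∀ β ∈ Q, t₀ ≠ 0 ∧ t₀ ∉ T) (v : AuxV F j) (hv : v ≠ 0) :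
    0 ≤ auxG ((j : ℤ) + 2) (auxS1 F j) (auxS2 F j) (auxU' F j) (auxU F j) (auxL F j) (auxP F j t₀)
      T Q v := by
  classical
  have e : auxG ((j : ℤ) + 2) (auxS1 F j) (auxS2 F j) (auxU' F j) (auxU F j) (auxL F j) (auxP F j t₀)
      T Q v = auxG0 v - (∑ t ∈ T, if v ∈ auxL F j t then 1 else 0)
    - (∑ t ∈ Q, if v ∈ auxP F j t₀ t then 1 else 0) := rfl
  rw [e]
  have h0 := auxG0_nonneg v hv
  have hT1 := aux_boole_le_one T (fun t => v ∈ auxL F j t) (auxL_disj v hv)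
  have hQ1 := aux_boole_le_one Q (fun t => v ∈ auxP F j t₀ t) (auxP_disj v hv t₀)
  by_cases h1 : ∃ t ∈ T, v ∈ auxL F j t
  · obtain ⟨t, ht, hvt⟩ := h1
    have h2 := auxG0_pos v hv t (hT t ht) hvt
    have h3 : (∑ t ∈ Q, if v ∈ auxP F j t₀ t then (1 : ℤ) else 0) = 0 := by
      apply Finset.sum_eq_zero
      intro β hβ
      rw [if_neg]
      intro h
      have := auxL_disj v hv _ _ (auxP_le _ _ _ h) hvt
      exact (hQ β hβ).2 (this ▸ ht)
    omega
  · have h3 : (∑ t ∈ T, if v ∈ auxL F j t then (1 : ℤ) else 0) = 0 := by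
      apply Finset.sum_eq_zero
      intro t ht
      rw [if_neg]
      exact fun h => h1 ⟨t, ht, h⟩
    by_cases h4 : ∃ β ∈ Q, v ∈ auxP F j t₀ β
    · obtain ⟨β, hβ, h⟩ := h4
      have h2 := auxG0_pos v hv t₀ (hQ β hβ).1 (auxP_le _ _ _ h)
      omega
    · have h5 : (∑ t ∈ Q, if v ∈ auxP F j t₀ t then (1 : ℤ) else 0) = 0 := by
        apply Finset.sum_eq_zero
        intro t ht
        rw [if_neg]
        exact fun h => h4 ⟨t, ht, h⟩
      omega
end pos

section gen
variable {F : Type} [Field F] [Fintype F] {V : Type} [AddCommGroup V] [Module F V] [Fintype V]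

theorem aux_exact_gen (φ : Module.Dual F V) (j : ℕ) (S₁ S₂ U' : Submodule F V)
    (U L P : F → Submodule F V) (T Q : Finset F)
    (h0 : Module.finrank F (⊤ : Submodule F V) = j + 4 + 1)
    (h1 : Module.finrank F S₁ = j + 3 + 1) (h2 : Module.finrank F S₂ = j + 3 + 1)
    (h3 : Module.finrank F U' = j + 2 + 1) (h4 : ∀ x, Module.finrank F (U x) = j + 2 + 1)
    (h5 : ∀ t, Module.finrank F (L t) = 1 + 1) (h6 : ∀ t, Module.finrank F (P t) = 0 + 1)
    (k0 : ∃ v ∈ (⊤ : Submodule F V), φ v ≠ 0) (k1 : ∃ v ∈ S₁, φ v ≠ 0) (k2 : ∃ v ∈ S₂, φ v ≠ 0)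
    (k3 : ∃ v ∈ U', φ v ≠ 0) (k4 : ∀ x, ∃ v ∈ U x, φ v ≠ 0) (k5 : ∀ t ∈ T, ∃ v ∈ L t, φ v ≠ 0)
    (k6 : ∀ t ∈ Q, ∃ v ∈ P t, φ v ≠ 0) :
    ((Fintype.card F : ℤ) - 1) * (((j : ℤ) + 2) * (Fintype.card F : ℤ) ^ (j + 4)
      - 2 * (Fintype.card F : ℤ) ^ (j + 3) - ((Fintype.card F : ℤ) - 1) * (Fintype.card F : ℤ) ^ (j + 2)
      - T.card * (Fintype.card F : ℤ) - Q.card) =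
    ((j : ℤ) + 2) * auxN (fun v => φ v ≠ 0) (⊤ : Submodule F V)
      - auxN (fun v => φ v ≠ 0) S₁ - auxN (fun v => φ v ≠ 0) S₂
      - (∑ x : F, auxN (fun v => φ v ≠ 0) (U x)) + auxN (fun v => φ v ≠ 0) U'
      - (∑ t ∈ T, auxN (fun v => φ v ≠ 0) (L t))
      - (∑ t ∈ Q, auxN (fun v => φ v ≠ 0) (P t)) := by
  rw [auxN_full φ _ _ h0 k0, auxN_full φ _ _ h1 k1, auxN_full φ _ _ h2 k2, auxN_full φ _ _ h3 k3,
    Finset.sum_congr rfl (fun x _ => auxN_full φ _ _ (h4 x) (k4 x)),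
    Finset.sum_congr rfl (fun t ht => auxN_full φ _ _ (h5 t) (k5 t ht)),
    Finset.sum_congr rfl (fun t ht => auxN_full φ _ _ (h6 t) (k6 t ht))]
  simp only [Finset.sum_const, Finset.card_univ, nsmul_eq_mul]
  generalize (Fintype.card F : ℤ) = q at *
  ring

theorem aux_len_gen (j : ℕ) (S₁ S₂ U' : Submodule F V)
    (U L P : F → Submodule F V) (T Q : Finset F)
    (h0 : Module.finrank F (⊤ : Submodule F V) = j + 4 + 1)
    (h1 : Module.finrank F S₁ = j + 3 + 1) (h2 : Module.finrank F S₂ = j + 3 + 1)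
    (h3 : Module.finrank F U' = j + 2 + 1) (h4 : ∀ x, Module.finrank F (U x) = j + 2 + 1)
    (h5 : ∀ t, Module.finrank F (L t) = 1 + 1) (h6 : ∀ t, Module.finrank F (P t) = 0 + 1) :
    ((j : ℤ) + 2) * ((Fintype.card F : ℤ) ^ (j + 5) - 1) - 2 * ((Fintype.card F : ℤ) ^ (j + 4) - 1)
      - ((Fintype.card F : ℤ) - 1) * ((Fintype.card F : ℤ) ^ (j + 3) - 1)
      - T.card * ((Fintype.card F : ℤ) ^ 2 - 1) - Q.card * ((Fintype.card F : ℤ) - 1) =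
    ((j : ℤ) + 2) * auxN (fun v => v ≠ 0) (⊤ : Submodule F V)
      - auxN (fun v => v ≠ 0) S₁ - auxN (fun v => v ≠ 0) S₂
      - (∑ x : F, auxN (fun v => v ≠ 0) (U x)) + auxN (fun v => v ≠ 0) U'
      - (∑ t ∈ T, auxN (fun v => v ≠ 0) (L t))
      - (∑ t ∈ Q, auxN (fun v => v ≠ 0) (P t)) := by
  rw [auxN_nonzero _ _ h0, auxN_nonzero _ _ h1, auxN_nonzero _ _ h2, auxN_nonzero _ _ h3,
    Finset.sum_congr rfl (fun x _ => auxN_nonzero _ _ (h4 x)),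
    Finset.sum_congr rfl (fun t _ => auxN_nonzero _ _ (h5 t)),
    Finset.sum_congr rfl (fun t _ => auxN_nonzero _ _ (h6 t))]
  simp only [Finset.sum_const, Finset.card_univ, nsmul_eq_mul]
  generalize (Fintype.card F : ℤ) = q at *
  ring

theorem aux_final [DecidableEq F] (j n d q t b : ℕ) (hq1 : ((Fintype.card F - 1 : ℕ) : ℤ) = (q : ℤ) - 1)
    (hF : Fintype.card F = q) (hV : Module.finrank F V = j + 5)
    (S₁ S₂ U' : Submodule F V) (U L P : F → Submodule F V) (T Q : Finset F)
    (hTc : T.card = t) (hQc : Q.card = b) (φ₀ : Module.Dual F V) (hφ₀ : φ₀ ≠ 0)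
    (hpos : ∀ v : V, v ≠ 0 → 0 ≤ auxG ((j : ℤ) + 2) S₁ S₂ U' U L P T Q v)
    (hd0 : 0 < d)
    (hdE : (d : ℤ) = ((j : ℤ) + 2) * (q : ℤ) ^ (j + 4) - 2 * (q : ℤ) ^ (j + 3)
      - ((q : ℤ) - 1) * (q : ℤ) ^ (j + 2) - t * q - b)
    (hge : ((q : ℤ) - 1) * n = ((j : ℤ) + 2) * ((q : ℤ) ^ (j + 5) - 1) - 2 * ((q : ℤ) ^ (j + 4) - 1)
      - ((q : ℤ) - 1) * ((q : ℤ) ^ (j + 3) - 1)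
      - t * ((q : ℤ) ^ 2 - 1) - b * ((q : ℤ) - 1))
    (hlen : ((j : ℤ) + 2) * ((Fintype.card F : ℤ) ^ (j + 5) - 1) - 2 * ((Fintype.card F : ℤ) ^ (j + 4) - 1)
      - ((Fintype.card F : ℤ) - 1) * ((Fintype.card F : ℤ) ^ (j + 3) - 1)
      - T.card * ((Fintype.card F : ℤ) ^ 2 - 1) - Q.card * ((Fintype.card F : ℤ) - 1) =
    ((j : ℤ) + 2) * auxN (fun v => v ≠ 0) (⊤ : Submodule F V)
      - auxN (fun v => v ≠ 0) S₁ - auxN (fun v => v ≠ 0) S₂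
      - (∑ x : F, auxN (fun v => v ≠ 0) (U x)) + auxN (fun v => v ≠ 0) U'
      - (∑ t ∈ T, auxN (fun v => v ≠ 0) (L t))
      - (∑ t ∈ Q, auxN (fun v => v ≠ 0) (P t)))
    (hlow : ∀ φ : Module.Dual F V, φ ≠ 0 →
    ((Fintype.card F : ℤ) - 1) * (((j : ℤ) + 2) * (Fintype.card F : ℤ) ^ (j + 4)
      - 2 * (Fintype.card F : ℤ) ^ (j + 3) - ((Fintype.card F : ℤ) - 1) * (Fintype.card F : ℤ) ^ (j + 2)
      - T.card * (Fintype.card F : ℤ) - Q.card) ≤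
    ((j : ℤ) + 2) * auxN (fun v => φ v ≠ 0) (⊤ : Submodule F V)
      - auxN (fun v => φ v ≠ 0) S₁ - auxN (fun v => φ v ≠ 0) S₂
      - (∑ x : F, auxN (fun v => φ v ≠ 0) (U x)) + auxN (fun v => φ v ≠ 0) U'
      - (∑ t ∈ T, auxN (fun v => φ v ≠ 0) (L t))
      - (∑ t ∈ Q, auxN (fun v => φ v ≠ 0) (P t)))
    (hex : ((Fintype.card F : ℤ) - 1) * (((j : ℤ) + 2) * (Fintype.card F : ℤ) ^ (j + 4)
      - 2 * (Fintype.card F : ℤ) ^ (j + 3) - ((Fintype.card F : ℤ) - 1) * (Fintype.card F : ℤ) ^ (j + 2)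
      - T.card * (Fintype.card F : ℤ) - Q.card) =
    ((j : ℤ) + 2) * auxN (fun v => φ₀ v ≠ 0) (⊤ : Submodule F V)
      - auxN (fun v => φ₀ v ≠ 0) S₁ - auxN (fun v => φ₀ v ≠ 0) S₂
      - (∑ x : F, auxN (fun v => φ₀ v ≠ 0) (U x)) + auxN (fun v => φ₀ v ≠ 0) U'
      - (∑ t ∈ T, auxN (fun v => φ₀ v ≠ 0) (L t))
      - (∑ t ∈ Q, auxN (fun v => φ₀ v ≠ 0) (P t))) :
    ∃ C : Submodule F (Fin n → F), IsLinearCodeWith F n (j + 5) d C := by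
  classical
  have hGsum : ∀ p : V → Prop, ¬ p 0 →
      ((∑ v : V, (if p v then (auxG ((j : ℤ) + 2) S₁ S₂ U' U L P T Q v).toNat else 0) : ℕ) : ℤ) =
        ∑ v : V, if p v then auxG ((j : ℤ) + 2) S₁ S₂ U' U L P T Q v else 0 := by
    intro p hp
    rw [Nat.cast_sum]
    apply Finset.sum_congr rfl
    intro v _
    split_ifs with h
    · have hv : v ≠ 0 := by rintro rfl; exact hp h
      exact Int.toNat_of_nonneg (hpos v hv)
    · rfl
  rw [hF, hTc, hQc] at hlen hex
  apply aux_code F V (j + 5) n d hV (fun v => (auxG ((j : ℤ) + 2) S₁ S₂ U' U L P T Q v).toNat) ?_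
    hd0 ?_ ?_ φ₀ hφ₀ ?_
  · intro c v hc
    exact congrArg Int.toNat (auxG_smul _ _ _ _ _ _ _ _ _ c v hc)
  · have h := hGsum (fun v => v ≠ 0) (by simp)
    rw [auxG_sum, ← hlen, ← hge, ← hq1] at h
    exact_mod_cast h.symm
  · intro φ hφ
    have h := hGsum (fun v => φ v ≠ 0) (by simp)
    rw [auxG_sum] at h
    have hl := hlow φ hφ
    rw [hF, hTc, hQc, ← h, ← hdE, ← hq1] at hl
    exact_mod_cast hl
  · have h := hGsum (fun v => φ₀ v ≠ 0) (by simp)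
    rw [auxG_sum, ← hex, ← hdE, ← hq1] at h
    exact_mod_cast h.symm

end gen

section weights
open Polynomial
variable {F : Type} [Field F] [Fintype F] {j : ℕ} [Fintype (AuxV F j)]

theorem aux_key (φ : Module.Dual F (AuxV F j)) :
    auxN (fun v => φ v ≠ 0) (auxS1 F j) + (∑ x : F, auxN (fun v => φ v ≠ 0) (auxU F j x))
      - auxN (fun v => φ v ≠ 0) (auxU' F j) ≤
    ((Fintype.card F : ℤ) ^ (j + 3 + 1) - (Fintype.card F : ℤ) ^ (j + 3))
      + ((Fintype.card F : ℤ) - 1) *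
        ((Fintype.card F : ℤ) ^ (j + 2 + 1) - (Fintype.card F : ℤ) ^ (j + 2)) := by
  classical
  set w : ℤ := (Fintype.card F : ℤ) ^ (j + 2 + 1) - (Fintype.card F : ℤ) ^ (j + 2) with hw
  have hU : ∀ x ∈ (Finset.univ : Finset F), auxN (fun v => φ v ≠ 0) (auxU F j x) ≤ w :=
    fun x _ => auxN_le φ _ _ (finrank_auxU x)
  have hS1 := auxN_le φ _ _ (finrank_auxS1 (F := F) (j := j))
  have hsum : (∑ x : F, auxN (fun v => φ v ≠ 0) (auxU F j x)) ≤ (Fintype.card F : ℤ) * w := by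
    have := Finset.sum_le_card_nsmul _ _ _ hU
    simpa using this
  by_cases h : ∃ v ∈ auxU' F j, φ v ≠ 0
  · have h1 := auxN_full φ _ _ (finrank_auxU' (F := F) (j := j)) h
    rw [← hw] at h1
    linarith
  · push Not at h
    rw [auxN_zero φ (auxU' F j) h]
    have hφ : ∀ v : AuxV F j, φ v = v.2.1 * φ (0, 1, 0) + v.2.2 * φ (0, 0, 1) := by
      intro v
      have e : v = (v.1, 0, 0) + v.2.1 • ((0, 1, 0) : AuxV F j) + v.2.2 • ((0, 0, 1) : AuxV F j) := by
        refine Prod.ext ?_ (Prod.ext ?_ ?_) <;> simp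
      conv_lhs => rw [e]
      rw [map_add, map_add, map_smul, map_smul, h (v.1, 0, 0) ((mem_auxU' _).2 ⟨rfl, rfl⟩)]
      simp
    by_cases hβ : φ (0, 1, 0) = 0
    · rw [auxN_zero φ (auxS1 F j)]
      · have h0 : (0 : ℤ) ≤ w := by
          rw [hw, sub_nonneg]
          apply pow_le_pow_right₀
          · exact_mod_cast Fintype.card_pos
          · omega
        have h1 : (1 : ℤ) ≤ Fintype.card F := by exact_mod_cast Fintype.card_pos
        have h2 : (Fintype.card F : ℤ) * w =
          (Fintype.card F : ℤ) ^ (j + 3 + 1) - (Fintype.card F : ℤ) ^ (j + 3) := by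
          rw [hw]; ring
        nlinarith
      · intro v hv
        rw [mem_auxS1] at hv
        rw [hφ, hβ, hv]; simp
    · have h3 : (∑ x : F, auxN (fun v => φ v ≠ 0) (auxU F j x)) ≤ ((Fintype.card F : ℤ) - 1) * w := by
        rw [← Finset.add_sum_erase _ _ (Finset.mem_univ (φ (0, 0, 1) / φ (0, 1, 0))), auxN_zero]
        · have := Finset.sum_le_card_nsmul
            (Finset.univ.erase (φ (0, 0, 1) / φ (0, 1, 0))) _ _
            (fun x _ => hU x (Finset.mem_univ x))
          rw [Finset.card_erase_of_mem (Finset.mem_univ _), Finset.card_univ, nsmul_eq_mul,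
            Nat.cast_sub Fintype.card_pos] at this
          simpa using this
        · intro v hv
          rw [mem_auxU] at hv
          rw [hφ]
          have h4 := hv.2
          field_simp at h4
          linear_combination h4
      linarith

theorem aux_low (T Q : Finset F) (t₀ : F) (φ : Module.Dual F (AuxV F j)) (hφ : φ ≠ 0) :
    ((Fintype.card F : ℤ) - 1) * (((j : ℤ) + 2) * (Fintype.card F : ℤ) ^ (j + 4)
      - 2 * (Fintype.card F : ℤ) ^ (j + 3) - ((Fintype.card F : ℤ) - 1) * (Fintype.card F : ℤ) ^ (j + 2)
      - T.card * (Fintype.card F : ℤ) - Q.card) ≤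
    ((j : ℤ) + 2) * auxN (fun v => φ v ≠ 0) (⊤ : Submodule F (AuxV F j))
      - auxN (fun v => φ v ≠ 0) (auxS1 F j) - auxN (fun v => φ v ≠ 0) (auxS2 F j)
      - (∑ x : F, auxN (fun v => φ v ≠ 0) (auxU F j x)) + auxN (fun v => φ v ≠ 0) (auxU' F j)
      - (∑ t ∈ T, auxN (fun v => φ v ≠ 0) (auxL F j t))
      - (∑ t ∈ Q, auxN (fun v => φ v ≠ 0) (auxP F j t₀ t)) := by
  have h1 := aux_key φ
  have h2 := auxN_le φ _ _ (finrank_auxS2 (F := F) (j := j))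
  have h3 := auxN_full φ (⊤ : Submodule F (AuxV F j)) (j + 4) (by rw [finrank_top, finrank_auxV]) (by
    by_contra hc
    push Not at hc
    exact hφ (LinearMap.ext fun v => hc v trivial))
  have h4 := Finset.sum_le_card_nsmul T _ _ (fun t _ => auxN_le φ _ _ (finrank_auxL (j := j) t))
  have h5 := Finset.sum_le_card_nsmul Q _ _ (fun t _ => auxN_le φ _ _ (finrank_auxP (j := j) t₀ t))
  rw [h3]
  rw [nsmul_eq_mul] at h4 h5
  generalize (Fintype.card F : ℤ) = q at *
  ring_nf at h1 h2 h4 h5 ⊢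
  linarith

theorem aux_exact (T Q : Finset F) (t₀ : F) (hT : ∀ t ∈ T, t ≠ 0) (hQ : ∀ β ∈ Q, t₀ ≠ 0) :
    ((Fintype.card F : ℤ) - 1) * (((j : ℤ) + 2) * (Fintype.card F : ℤ) ^ (j + 4)
      - 2 * (Fintype.card F : ℤ) ^ (j + 3) - ((Fintype.card F : ℤ) - 1) * (Fintype.card F : ℤ) ^ (j + 2)
      - T.card * (Fintype.card F : ℤ) - Q.card) =
    ((j : ℤ) + 2) * auxN (fun v => auxphi F j v ≠ 0) (⊤ : Submodule F (AuxV F j))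
      - auxN (fun v => auxphi F j v ≠ 0) (auxS1 F j) - auxN (fun v => auxphi F j v ≠ 0) (auxS2 F j)
      - (∑ x : F, auxN (fun v => auxphi F j v ≠ 0) (auxU F j x))
      + auxN (fun v => auxphi F j v ≠ 0) (auxU' F j)
      - (∑ t ∈ T, auxN (fun v => auxphi F j v ≠ 0) (auxL F j t))
      - (∑ t ∈ Q, auxN (fun v => auxphi F j v ≠ 0) (auxP F j t₀ t)) := by
  have hev : ∀ v : AuxV F j, auxphi F j v = v.1.1.coeff 1 + v.2.1 := fun v => rfl
  let vx : F → AuxV F j := fun x => (auxA F j (X - C x) (by simp), 0, 0)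
  have hvx : ∀ x, auxphi F j (vx x) ≠ 0 := by
    intro x
    rw [hev]
    simp [vx, auxA, coeff_X, coeff_C]
  have hg1 : ∀ t : F, auxphi F j (auxg1 F j t) = t := by
    intro t
    rw [hev]
    simp [auxg1, auxA, coeff_X_pow]
  have hg2 : ∀ t : F, auxphi F j (auxg2 F j t) = 0 := by
    intro t
    rw [hev]
    simp [auxg2, auxA, coeff_C]
  exact aux_exact_gen (auxphi F j) j (auxS1 F j) (auxS2 F j) (auxU' F j) (auxU F j) (auxL F j)
    (auxP F j t₀) T Q (by rw [finrank_top, finrank_auxV]) finrank_auxS1 finrank_auxS2 finrank_auxU'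
    finrank_auxU finrank_auxL (finrank_auxP t₀) ⟨vx 0, trivial, hvx 0⟩
    ⟨vx 0, (mem_auxS1 _).2 rfl, hvx 0⟩
    ⟨vx 0, (mem_auxS2 _).2 (by simp [vx, auxA, coeff_X]), hvx 0⟩
    ⟨vx 0, (mem_auxU' _).2 ⟨rfl, rfl⟩, hvx 0⟩
    (fun x => ⟨vx x, (mem_auxU _ _).2 ⟨by simp [vx, auxA], by simp [vx]⟩, hvx x⟩)
    (fun t ht => ⟨auxg1 F j t, Submodule.subset_span (Set.mem_insert _ _), by
      rw [hg1]; exact hT t ht⟩)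
    (fun t ht => ⟨auxg1 F j t₀ + t • auxg2 F j t₀, Submodule.mem_span_singleton_self _, by
      rw [map_add, map_smul, hg1, hg2]; simpa using hQ t ht⟩)

theorem aux_len (T Q : Finset F) (t₀ : F) :
    ((j : ℤ) + 2) * ((Fintype.card F : ℤ) ^ (j + 5) - 1) - 2 * ((Fintype.card F : ℤ) ^ (j + 4) - 1)
      - ((Fintype.card F : ℤ) - 1) * ((Fintype.card F : ℤ) ^ (j + 3) - 1)
      - T.card * ((Fintype.card F : ℤ) ^ 2 - 1) - Q.card * ((Fintype.card F : ℤ) - 1) =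
    ((j : ℤ) + 2) * auxN (fun v => v ≠ 0) (⊤ : Submodule F (AuxV F j))
      - auxN (fun v => v ≠ 0) (auxS1 F j) - auxN (fun v => v ≠ 0) (auxS2 F j)
      - (∑ x : F, auxN (fun v => v ≠ 0) (auxU F j x)) + auxN (fun v => v ≠ 0) (auxU' F j)
      - (∑ t ∈ T, auxN (fun v => v ≠ 0) (auxL F j t))
      - (∑ t ∈ Q, auxN (fun v => v ≠ 0) (auxP F j t₀ t)) := by
  exact aux_len_gen j (auxS1 F j) (auxS2 F j) (auxU' F j) (auxU F j) (auxL F j)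
    (auxP F j t₀) T Q (by rw [finrank_top, finrank_auxV]) finrank_auxS1 finrank_auxS2 finrank_auxU'
    finrank_auxU finrank_auxL (finrank_auxP t₀)

end weights


theorem aux_dpos (j q d : ℕ) (hq3 : 3 ≤ q)
    (h : ((j : ℤ) + 5 - 3) * (q : ℤ) ^ (j + 4) - 3 * (q : ℤ) ^ (j + 3) + (q : ℤ) ^ (j + 2)
      - (q : ℤ) ^ 2 + (q : ℤ) ≤ (d : ℤ)) : 0 < d := by
  have hq3' : (3 : ℤ) ≤ q := by exact_mod_cast hq3
  have p1 : (q : ℤ) ^ (j + 4) = q * (q : ℤ) ^ (j + 3) := by ring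
  have p2 : (0 : ℤ) < (q : ℤ) ^ (j + 3) := by positivity
  have p3 : (q : ℤ) ^ 2 ≤ (q : ℤ) ^ (j + 2) := pow_le_pow_right₀ (by linarith) (by omega)
  have p4 : 3 * (q : ℤ) ^ (j + 3) ≤ (q : ℤ) ^ (j + 4) := by
    rw [p1]; exact mul_le_mul_of_nonneg_right hq3' p2.le
  have p5 : (0 : ℤ) ≤ (j : ℤ) * (q : ℤ) ^ (j + 4) := by positivity
  have : (0 : ℤ) < d := by
    generalize (q : ℤ) ^ (j + 4) = X at *
    generalize (q : ℤ) ^ (j + 3) = Y at *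
    generalize (q : ℤ) ^ (j + 2) = Z at *
    have : ((j : ℤ) + 5 - 3) * X = j * X + 2 * X := by ring
    linarith
  exact_mod_cast this

/-- For every integer `k ≥ 5`, every prime power `q ≥ k - 2` and every `d` with
`(k-3)q^{k-1} - 3q^{k-2} + q^{k-3} - q² + q ≤ d ≤ (k-3)q^{k-1} - 3q^{k-2} + q^{k-3}`
there exists a Griesmer `[g_q(k,d), k, d]_q` code. -/
theorem statement0 (k q d : ℕ) (hk : 5 ≤ k) (hq : IsPrimePow q) (hkq : k - 2 ≤ q)
    (hd1 : ((k : ℤ) - 3) * (q : ℤ) ^ (k - 1) - 3 * (q : ℤ) ^ (k - 2) + (q : ℤ) ^ (k - 3)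
      - (q : ℤ) ^ 2 + (q : ℤ) ≤ (d : ℤ))
    (hd2 : (d : ℤ) ≤ ((k : ℤ) - 3) * (q : ℤ) ^ (k - 1) - 3 * (q : ℤ) ^ (k - 2)
      + (q : ℤ) ^ (k - 3))
    (F : Type) [Field F] [Fintype F] [DecidableEq F] (hF : Fintype.card F = q) :
    ∃ C : Submodule F (Fin (griesmer q k d) → F),
      IsLinearCodeWith F (griesmer q k d) k d C := by
  classical
  obtain ⟨j, rfl⟩ := Nat.exists_eq_add_of_le hk
  rw [add_comm 5 j] at *
  have e1 : j + 5 - 1 = j + 4 := rfl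
  have e2 : j + 5 - 2 = j + 3 := rfl
  have e3 : j + 5 - 3 = j + 2 := rfl
  rw [e1, e2, e3] at hd1 hd2
  rw [e2] at hkq
  have hq3 : 3 ≤ q := by omega
  push_cast at hd1 hd2
  obtain ⟨e, he⟩ : ∃ e : ℕ, (d : ℤ) + e = ((j : ℤ) + 2) * (q : ℤ) ^ (j + 4)
      - 3 * (q : ℤ) ^ (j + 3) + (q : ℤ) ^ (j + 2) :=
    ⟨(((j : ℤ) + 2) * (q : ℤ) ^ (j + 4) - 3 * (q : ℤ) ^ (j + 3) + (q : ℤ) ^ (j + 2) - d).toNat, by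
      rw [Int.toNat_of_nonneg]
      · ring
      · linarith⟩
  have hele : (e : ℤ) + q ≤ (q : ℤ) ^ 2 := by linarith
  have hele' : e + q ≤ q * q := by
    rw [pow_two] at hele
    exact_mod_cast hele
  obtain ⟨t, ht⟩ : ∃ t, t = e / q := ⟨_, rfl⟩
  obtain ⟨b, hb⟩ : ∃ b, b = e % q := ⟨_, rfl⟩
  have htb : t * q + b = e := by rw [ht, hb, mul_comm]; exact Nat.div_add_mod e q
  have hbq : b < q := by rw [hb]; exact Nat.mod_lt _ (by omega)
  have htq : t < q := by
    by_contra h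
    have := Nat.mul_le_mul_right q (not_lt.1 h)
    omega
  have htq' : 0 < b → t + 1 < q := by
    intro h
    by_contra h2
    have h3 : t + 1 = q := by omega
    have : q * q = t * q + q := by rw [← h3]; ring
    omega
  have hE : d + (2 * q ^ (j + 3) + (q - 1) * q ^ (j + 2) + t * q + b) = (j + 2) * q ^ (j + 5 - 1) := by
    rw [e1, add_assoc _ (t * q) b, htb]
    zify [show 1 ≤ q by omega]
    linear_combination he
  have hdE : (d : ℤ) = ((j : ℤ) + 2) * (q : ℤ) ^ (j + 4) - 2 * (q : ℤ) ^ (j + 3)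
      - ((q : ℤ) - 1) * (q : ℤ) ^ (j + 2) - t * q - b := by
    rw [e1] at hE
    zify [show 1 ≤ q by omega] at hE
    linear_combination hE
  have hG := aux_griesmer q (j + 5) (j + 2) d _ (by omega) (by omega) hE
  have hfl := aux_floor q j t b hq3 htq hbq
  have hge := aux_geom q (j + 5) (j + 2)
  rw [← hG, Nat.cast_add, mul_add, hfl] at hge
  have hd0 : 0 < d := aux_dpos j q d hq3 hd1
  -- choice of the deleted lines and points
  have hcu : (Finset.univ.erase (0 : F)).card = q - 1 := by
    rw [Finset.card_erase_of_mem (Finset.mem_univ _), Finset.card_univ, hF]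
  obtain ⟨T, hTs, hTc⟩ := Finset.exists_subset_card_eq
    (show t ≤ (Finset.univ.erase (0 : F)).card by omega)
  obtain ⟨Q, _, hQc⟩ := Finset.exists_subset_card_eq
    (show b ≤ (Finset.univ : Finset F).card by rw [Finset.card_univ, hF]; omega)
  have hT : ∀ t ∈ T, t ≠ 0 := fun t ht => Finset.ne_of_mem_erase (hTs ht)
  obtain ⟨t₀, hQ⟩ : ∃ t₀ : F, ∀ β ∈ Q, t₀ ≠ 0 ∧ t₀ ∉ T := by
    by_cases h0 : b = 0
    · refine ⟨0, fun β hβ => ?_⟩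
      rw [h0, Finset.card_eq_zero] at hQc
      simp [hQc] at hβ
    · have h1 := htq' (by omega)
      obtain ⟨t₀, h2, h3⟩ := Finset.exists_mem_notMem_of_card_lt_card
        (show T.card < (Finset.univ.erase (0 : F)).card by omega)
      exact ⟨t₀, fun _ _ => ⟨Finset.ne_of_mem_erase h2, h3⟩⟩
  have : Finite (AuxV F j) := Module.finite_of_finite F
  have : Fintype (AuxV F j) := Fintype.ofFinite _
  have hq1 : ((Fintype.card F - 1 : ℕ) : ℤ) = (q : ℤ) - 1 := by
    rw [hF, Nat.cast_sub (by omega)]; rfl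
  have hφ₀ : auxphi F j ≠ 0 := by
    intro h
    have h1 : auxphi F j ((0, 1, 0) : AuxV F j) = 0 := by rw [h]; rfl
    have h2 : auxphi F j ((0, 1, 0) : AuxV F j) = (0 : Polynomial F).coeff 1 + 1 := rfl
    rw [h2] at h1
    simp at h1
  have hge' : ((q : ℤ) - 1) * (griesmer q (j + 5) d : ℕ) =
      ((j : ℤ) + 2) * ((q : ℤ) ^ (j + 5) - 1) - 2 * ((q : ℤ) ^ (j + 4) - 1)
      - ((q : ℤ) - 1) * ((q : ℤ) ^ (j + 3) - 1)
      - t * ((q : ℤ) ^ 2 - 1) - b * ((q : ℤ) - 1) := by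
    push_cast at hge ⊢
    linear_combination hge
  exact aux_final j (griesmer q (j + 5) d) d q t b hq1 hF finrank_auxV (auxS1 F j) (auxS2 F j)
    (auxU' F j) (auxU F j) (auxL F j) (auxP F j t₀) T Q hTc hQc (auxphi F j) hφ₀
    (auxG_nonneg T Q t₀ hT hQ) hd0 hdE hge' (aux_len T Q t₀) (aux_low T Q t₀)
    (aux_exact T Q t₀ hT (fun β hβ => (hQ β hβ).1))
end

section
/- For every integer k ≥ 5, every prime power q with q ≥ max{5, k−2}, and every integer d satisfying (k−2)q^{k−1} − 5q^{k−2} + 2q^{k−3} − q² + q ≤ d ≤ (k−2)q^{k−1} − 5q^{k−2} + 2q^{k−3}, there exists an [g_q(k,d), k, d]_q linear code, i.e., a code attaining the Griesmer bound. -/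
lemma exists_code_nat {F W : Type} [Field F] [DecidableEq F] [AddCommGroup W] [Module F W]
    {k : ℕ} (hk : Module.finrank F W = k) (hk0 : 0 < k) (f : W →ₗ[F] (ℕ → F))
    (N D b n d : ℕ) (hf : ∀ w, w ≠ 0 → D ≤ ((Finset.range N).filter (fun i => f w i ≠ 0)).card)
    (hN : N ≤ n + b) (hd : d + b ≤ D) (hd1 : 1 ≤ d) :
    ∃ C : Submodule F (Fin n → F), IsLinearCodeWith F n k d C := by
  classical
  let P : ℕ → Prop := fun j => ∀ w, w ≠ 0 →
    d ≤ ((Finset.range j).filter (fun i => f w i ≠ 0)).card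
  have hPn : P n := by
    intro w hw
    have h1 := hf w hw
    have h2 : (Finset.range N).filter (fun i => f w i ≠ 0) ⊆
        (Finset.range n).filter (fun i => f w i ≠ 0) ∪ Finset.Ico n N := by
      intro i hi
      simp only [Finset.mem_filter, Finset.mem_range, Finset.mem_union, Finset.mem_Ico] at hi ⊢
      by_cases h : i < n
      · exact Or.inl ⟨h, hi.2⟩
      · exact Or.inr ⟨by omega, hi.1⟩
    have h3 := (Finset.card_le_card h2).trans (Finset.card_union_le _ _)
    rw [Nat.card_Ico] at h3
    omega
  have hnt : Nontrivial W := Module.nontrivial_of_finrank_pos (R := F) (by omega)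
  have hex : ∃ j, P j := ⟨n, hPn⟩
  obtain ⟨j, hjn, hPj, hmin⟩ : ∃ j, j ≤ n ∧ P j ∧ ∀ i < j, ¬ P i :=
    ⟨Nat.find hex, Nat.find_min' hex hPn, Nat.find_spec hex, fun i hi => Nat.find_min hex hi⟩
  have hj0 : j ≠ 0 := by
    rintro rfl
    obtain ⟨w, hw⟩ := exists_ne (0 : W)
    have := hPj w hw
    simp at this
    omega
  obtain ⟨i, rfl⟩ := Nat.exists_eq_succ_of_ne_zero hj0
  have hnP := hmin i (Nat.lt_succ_self i)
  simp only [P, not_forall, not_le] at hnP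
  obtain ⟨w0, hw0, hlt⟩ := hnP
  let g : W →ₗ[F] (Fin n → F) :=
    { toFun := fun w a => if (a : ℕ) < i + 1 then f w a else 0
      map_add' := by
        intro x y; ext a; simp only [map_add, Pi.add_apply]; split_ifs <;> simp
      map_smul' := by
        intro c x; ext a; simp only [map_smul, Pi.smul_apply, RingHom.id_apply]
        split_ifs <;> simp }
  have hg : ∀ w, hammingNorm (g w) =
      ((Finset.range (i + 1)).filter (fun a => f w a ≠ 0)).card := by
    intro w
    unfold hammingNorm
    refine Finset.card_bij (fun a _ => (a : ℕ)) ?_ ?_ ?_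
    · intro a ha
      simp only [Finset.mem_filter, Finset.mem_univ, true_and, g, LinearMap.coe_mk,
        AddHom.coe_mk, Finset.mem_range] at ha ⊢
      by_cases h : (a : ℕ) < i + 1
      · simpa [h] using ha
      · simp [h] at ha
    · intro a _ c _ h
      exact Fin.ext h
    · intro a ha
      simp only [Finset.mem_filter, Finset.mem_range] at ha
      refine ⟨⟨a, by omega⟩, ?_, rfl⟩
      simp only [Finset.mem_filter, Finset.mem_univ, true_and, g, LinearMap.coe_mk,
        AddHom.coe_mk, ha.1, if_true]
      exact ha.2
  have hginj : Function.Injective g := by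
    rw [← LinearMap.ker_eq_bot, LinearMap.ker_eq_bot']
    intro w hw
    by_contra hne
    have h1 := hPj w hne
    rw [← Nat.succ_eq_add_one] at hg
    rw [← hg w, hw, hammingNorm_zero] at h1
    omega
  refine ⟨LinearMap.range g, ?_, ?_, ?_⟩
  · rw [LinearMap.finrank_range_of_inj hginj, hk]
  · rintro c ⟨w, rfl⟩ hc
    rw [hg]
    exact hPj w (by rintro rfl; simp at hc)
  · refine ⟨g w0, ⟨w0, rfl⟩, fun h => hw0 (hginj (by rw [h, map_zero])), ?_⟩
    rw [hg]
    apply le_antisymm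
    · rw [Finset.range_add_one, Finset.filter_insert]
      split_ifs
      · exact (Finset.card_insert_le _ _).trans hlt
      · exact hlt.le
    · exact hPj w0 hw0

lemma exists_code_fintype {F W ι : Type} [Field F] [DecidableEq F] [AddCommGroup W] [Module F W]
    [Fintype ι]
    {k : ℕ} (hk : Module.finrank F W = k) (hk0 : 0 < k) (f : W →ₗ[F] (ι → F))
    (D b n d : ℕ) (hf : ∀ w, w ≠ 0 → D ≤ (Finset.univ.filter (fun i => f w i ≠ 0)).card)
    (hN : Fintype.card ι ≤ n + b) (hd : d + b ≤ D) (hd1 : 1 ≤ d) :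
    ∃ C : Submodule F (Fin n → F), IsLinearCodeWith F n k d C := by
  classical
  let e := Fintype.equivFin ι
  let g : W →ₗ[F] (ℕ → F) :=
    { toFun := fun w a => if h : a < Fintype.card ι then f w (e.symm ⟨a, h⟩) else 0
      map_add' := by
        intro x y; ext a; simp only [map_add, Pi.add_apply]; split_ifs <;> simp
      map_smul' := by
        intro c x; ext a; simp only [map_smul, Pi.smul_apply, RingHom.id_apply]
        split_ifs <;> simp }
  refine exists_code_nat hk hk0 g (Fintype.card ι) D b n d ?_ hN hd hd1
  intro w hw
  refine (hf w hw).trans (Finset.card_le_card_of_injOn (fun i => (e i : ℕ)) ?_ ?_)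
  · intro i hi
    simp at hi
    simp [g, hi]
  · intro i _ j _ h
    exact e.injective (Fin.ext h)

open scoped LinearAlgebra.Projectivization in
lemma sum_proj {F V : Type} [Field F] [Fintype F] [AddCommGroup V] [Module F V]
    [Fintype V] [DecidableEq V] [Fintype (ℙ F V)] (g : V → ℤ) (h0 : g 0 = 0)
    (hg : ∀ (c : F) (v : V), c ≠ 0 → g (c • v) = g v) :
    ∑ v, g v = ((Fintype.card F : ℤ) - 1) * ∑ p : ℙ F V, g p.rep := by
  classical
  have h1 : ∑ v, g v = ∑ v ∈ Finset.univ.filter (fun v : V => v ≠ 0), g v := by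
    rw [Finset.sum_filter]
    refine Finset.sum_congr rfl fun v _ => ?_
    by_cases h : v = 0 <;> simp [h, h0]
  have h2 : ∑ v ∈ Finset.univ.filter (fun v : V => v ≠ 0), g v
      = ∑ x : ℙ F V × Fˣ, g x.1.rep := by
    symm
    refine Finset.sum_bij (fun x _ => (x.2 : F) • x.1.rep) ?_ ?_ ?_ ?_
    · intro x _
      simp [x.1.rep_nonzero]
    · rintro ⟨p, u⟩ _ ⟨p', u'⟩ _ h
      have hp : p = p' := by
        rw [← p.mk_rep, ← p'.mk_rep, Projectivization.mk_eq_mk_iff]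
        refine ⟨u⁻¹ * u', ?_⟩
        simp only at h
        rw [mul_smul]
        change u⁻¹ • ((u' : F) • p'.rep) = p.rep
        rw [← h]
        change u⁻¹ • (u • p.rep) = p.rep
        simp
      subst hp
      have := smul_left_injective F p.rep_nonzero h
      simp only [Prod.mk.injEq, true_and]
      exact Units.ext this
    · intro v hv
      have hv' : v ≠ 0 := by simpa using hv
      obtain ⟨a, ha⟩ := Projectivization.exists_smul_eq_mk_rep F v hv'
      refine ⟨(Projectivization.mk F v hv', a⁻¹), Finset.mem_univ _, ?_⟩
      simp only
      rw [← ha]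
      change a⁻¹ • (a • v) = v
      simp
    · intro x _
      exact (hg _ _ x.2.ne_zero).symm
  rw [h1, h2, Fintype.sum_prod_type, Finset.mul_sum]
  refine Finset.sum_congr rfl fun p _ => ?_
  simp only [Finset.sum_const, Finset.card_univ, Fintype.card_units]
  rw [nsmul_eq_mul, Nat.cast_sub Fintype.card_pos]
  simp

open scoped LinearAlgebra.Projectivization in
lemma exists_code_mult {F V : Type} [Field F] [Fintype F] [DecidableEq F] [AddCommGroup V]
    [Module F V] [Fintype V] [DecidableEq V]
    {k : ℕ} (hk : Module.finrank F V = k) (hk0 : 0 < k) (m : V → ℤ)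
    (hm0 : ∀ v, v ≠ 0 → 0 ≤ m v)
    (hm : ∀ (c : F) (v : V), c ≠ 0 → m (c • v) = m v)
    (D b n d : ℕ)
    (hD : ∀ φ : Module.Dual F V, φ ≠ 0 →
      ((Fintype.card F : ℤ) - 1) * D ≤ ∑ v, if φ v ≠ 0 then m v else 0)
    (hN : (∑ v, if v ≠ 0 then m v else 0) ≤ ((Fintype.card F : ℤ) - 1) * (n + b))
    (hd : d + b ≤ D) (hd1 : 1 ≤ d) :
    ∃ C : Submodule F (Fin n → F), IsLinearCodeWith F n k d C := by
  classical
  have hq : (0 : ℤ) < (Fintype.card F : ℤ) - 1 := by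
    have := Fintype.one_lt_card (α := F); omega
  let _ : Fintype (ℙ F V) := Fintype.ofFinite _
  let ι := Σ p : ℙ F V, Fin (m p.rep).toNat
  let f : Module.Dual F V →ₗ[F] (ι → F) :=
    { toFun := fun φ i => φ i.1.rep
      map_add' := by intro x y; rfl
      map_smul' := by intro c x; rfl }
  have hk' : Module.finrank F (Module.Dual F V) = k := by
    rw [Subspace.dual_finrank_eq, hk]
  refine exists_code_fintype hk' hk0 f D b n d ?_ ?_ hd hd1
  · intro φ hφ
    have h1 := hD φ hφ
    rw [sum_proj (F := F) _ (by simp)] at h1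
    · have h2 := le_of_mul_le_mul_left h1 hq
      rw [← Nat.cast_le (α := ℤ)]
      refine h2.trans (le_of_eq ?_)
      rw [Finset.card_filter, Fintype.sum_sigma]
      push_cast
      refine Finset.sum_congr rfl fun p _ => ?_
      change _ = ∑ y : Fin (m p.rep).toNat, if φ p.rep ≠ 0 then (1 : ℤ) else 0
      rw [Finset.sum_const, Finset.card_univ, Fintype.card_fin, nsmul_eq_mul,
        Int.toNat_of_nonneg (hm0 _ p.rep_nonzero)]
      split_ifs <;> simp
    · intro c v hc
      simp [hc, hm]
  · rw [sum_proj (F := F) _ (by simp)] at hN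
    · have h2 := le_of_mul_le_mul_left hN hq
      rw [← Nat.cast_le (α := ℤ)]
      refine le_trans (le_of_eq ?_) (h2.trans (le_of_eq (by push_cast; ring)))
      rw [Fintype.card_sigma]
      push_cast
      refine Finset.sum_congr rfl fun p _ => ?_
      simp [p.rep_nonzero, hm0 _ p.rep_nonzero]
    · intro c v hc
      simp [hc, hm]

lemma card_sub_ne {F V : Type} [Field F] [Fintype F] [DecidableEq F] [AddCommGroup V]
    [Module F V] [Fintype V] [DecidableEq V] (U : Submodule F V) [DecidablePred (· ∈ U)] (r : ℕ)
    (hr : Module.finrank F U = r) :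
    (∑ v : V, if v ∈ U ∧ v ≠ 0 then (1 : ℤ) else 0) = (Fintype.card F : ℤ) ^ r - 1 := by
  classical
  have h1 : (∑ v : V, if v ∈ U ∧ v ≠ 0 then (1 : ℤ) else 0)
      = (∑ v : V, if v ∈ U then (1 : ℤ) else 0) - ∑ v : V, if v = 0 then (1 : ℤ) else 0 := by
    rw [← Finset.sum_sub_distrib]
    refine Finset.sum_congr rfl fun v _ => ?_
    by_cases h : v = 0
    · simp [h]
    · simp [h]
  have h2 : (∑ v : V, if v ∈ U then (1 : ℤ) else 0) = (Fintype.card F : ℤ) ^ r := by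
    rw [Finset.sum_boole, ← hr, ← Fintype.card_subtype]
    have := Module.card_eq_pow_finrank (K := F) (V := U)
    rw [← Nat.cast_pow, ← this]
  rw [h1, h2]
  simp

lemma card_sub_phi {F V : Type} [Field F] [Fintype F] [DecidableEq F] [AddCommGroup V]
    [Module F V] [Fintype V] [DecidableEq V] (U : Submodule F V) [DecidablePred (· ∈ U)] (r : ℕ)
    (hr : Module.finrank F U = r + 1) (φ : Module.Dual F V) (hφ : ∃ v ∈ U, φ v ≠ 0) :
    (∑ v : V, if v ∈ U ∧ φ v ≠ 0 then (1 : ℤ) else 0) =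
      ((Fintype.card F : ℤ) - 1) * (Fintype.card F : ℤ) ^ r := by
  classical
  have hs : Module.finrank F (U ⊓ LinearMap.ker φ : Submodule F V) = r := by
    have h1 := (φ.domRestrict U).finrank_range_add_finrank_ker
    have hne : φ.domRestrict U ≠ 0 := by
      obtain ⟨v, hv, h⟩ := hφ
      intro h0
      exact h (by simpa using LinearMap.congr_fun h0 ⟨v, hv⟩)
    have h2 : LinearMap.range (φ.domRestrict U) = ⊤ :=
      LinearMap.range_eq_top.2 (LinearMap.surjective hne)
    rw [h2, finrank_top, Module.finrank_self, hr] at h1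
    have h3 : (LinearMap.ker (φ.domRestrict U)).map U.subtype = U ⊓ LinearMap.ker φ := by
      ext v; simp [and_comm]
    rw [← h3, Submodule.finrank_map_subtype_eq]
    omega
  have e1 := card_sub_ne U _ hr
  have e2 := card_sub_ne (U ⊓ LinearMap.ker φ) _ hs
  have : (∑ v : V, if v ∈ U ∧ φ v ≠ 0 then (1 : ℤ) else 0) =
    (∑ v : V, if v ∈ U ∧ v ≠ 0 then (1 : ℤ) else 0) -
    (∑ v : V, if v ∈ (U ⊓ LinearMap.ker φ) ∧ v ≠ 0 then (1 : ℤ) else 0) := by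
    rw [← Finset.sum_sub_distrib]
    refine Finset.sum_congr rfl fun v _ => ?_
    by_cases h : v = 0
    · simp [h]
    · by_cases h' : φ v = 0 <;> simp [h, h']
  rw [this, e1, e2]
  ring

lemma card_sub_phi_le {F V : Type} [Field F] [Fintype F] [DecidableEq F] [AddCommGroup V]
    [Module F V] [Fintype V] [DecidableEq V] (U : Submodule F V) [DecidablePred (· ∈ U)] (r : ℕ)
    (hr : Module.finrank F U = r + 1) (φ : Module.Dual F V) :
    (∑ v : V, if v ∈ U ∧ φ v ≠ 0 then (1 : ℤ) else 0) ≤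
      ((Fintype.card F : ℤ) - 1) * (Fintype.card F : ℤ) ^ r := by
  by_cases h : ∃ v ∈ U, φ v ≠ 0
  · exact (card_sub_phi U r hr φ h).le
  · push Not at h
    have hq : (0 : ℤ) ≤ (Fintype.card F : ℤ) - 1 := by
      have := Fintype.one_lt_card (α := F); omega
    rw [Finset.sum_eq_zero]
    · positivity
    · intro v _
      rw [if_neg]
      rintro ⟨a, b⟩
      exact b (h v a)

lemma le_ceil_term (q i d : ℕ) (hq : 0 < q) (X : ℤ) (h : (X - 1) * (q : ℤ) ^ i < d) :
    X ≤ (((d + q ^ i - 1) / q ^ i : ℕ) : ℤ) := by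
  have hp : 0 < q ^ i := pow_pos hq i
  have h1 : ((d + q ^ i - 1 : ℕ) : ℤ) = (d : ℤ) + (q : ℤ) ^ i - 1 := by
    rw [Nat.cast_sub (by omega)]; push_cast; ring
  rw [Int.natCast_div, h1]
  push_cast
  rw [Int.le_ediv_iff_mul_le (by positivity)]
  linarith

lemma griesmer_lower (m q a b d : ℕ) (hq : 5 ≤ q) (hb : b < q)
    (hab : (a : ℤ) * q + b ≤ (q : ℤ) ^ 2 - q)
    (hd : (d : ℤ) = ((m : ℤ) + 3) * (q : ℤ) ^ (m + 4) - 5 * (q : ℤ) ^ (m + 3)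
      + 2 * (q : ℤ) ^ (m + 2) - a * q - b) :
    ((m : ℤ) + 3) * ((q : ℤ) ^ (m + 5) - 1) + ((q : ℤ) ^ (m + 3) - 1)
      - 4 * ((q : ℤ) ^ (m + 4) - 1) - ((q : ℤ) - 1) * ((q : ℤ) ^ (m + 3) - 1)
      - a * ((q : ℤ) ^ 2 - 1) ≤ ((q : ℤ) - 1) * ((griesmer q (m + 5) d : ℕ) + b) := by
  have hq' : (5 : ℤ) ≤ q := by exact_mod_cast hq
  have hq0 : 0 < q := by omega
  have hb' : (b : ℤ) + 1 ≤ q := by exact_mod_cast hb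
  have hb0 : (0 : ℤ) ≤ b := by positivity
  have hm0 : (0 : ℤ) ≤ m := by positivity
  have hQ : (q : ℤ) ^ 2 ≤ (q : ℤ) ^ (m + 2) := pow_le_pow_right₀ (by linarith) (by omega)
  set A : ℤ := ((m : ℤ) + 3) * (q : ℤ) ^ 2 - 5 * q + 2 with hA
  have hd' : (d : ℤ) = A * (q : ℤ) ^ (m + 2) - a * q - b := by rw [hd, hA]; ring
  have t0 : (d : ℤ) ≤ (((d + q ^ 0 - 1) / q ^ 0 : ℕ) : ℤ) := by simp
  have t1 : A * (q : ℤ) ^ (m + 1) - a ≤ (((d + q ^ 1 - 1) / q ^ 1 : ℕ) : ℤ) := by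
    apply le_ceil_term _ _ _ hq0
    rw [hd']
    have : A * (q : ℤ) ^ (m + 2) = A * (q : ℤ) ^ (m + 1) * q := by ring
    rw [this]
    linarith
  have tm : ∀ j ∈ Finset.range (m + 1), A * (q : ℤ) ^ (m + 1 - 1 - j) ≤
      (((d + q ^ (j + 1 + 1) - 1) / q ^ (j + 1 + 1) : ℕ) : ℤ) := by
    intro j hj
    have hj' : j < m + 1 := by simpa using hj
    apply le_ceil_term _ _ _ hq0
    rw [hd']
    have : A * (q : ℤ) ^ (m + 2) =
        A * (q : ℤ) ^ (m + 1 - 1 - j) * (q : ℤ) ^ (j + 1 + 1) := by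
      rw [mul_assoc, ← pow_add]; congr 2; omega
    rw [this]
    have h2 : (q : ℤ) ^ 2 ≤ (q : ℤ) ^ (j + 1 + 1) :=
      pow_le_pow_right₀ (by linarith) (by omega)
    linarith
  have t3 : ((m : ℤ) + 3) * q - 4 ≤ (((d + q ^ (m + 3) - 1) / q ^ (m + 3) : ℕ) : ℤ) := by
    apply le_ceil_term _ _ _ hq0
    rw [hd]
    have : (((m : ℤ) + 3) * q - 4 - 1) * (q : ℤ) ^ (m + 3) =
      ((m : ℤ) + 3) * (q : ℤ) ^ (m + 4) - 5 * (q : ℤ) ^ (m + 3) := by ring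
    rw [this]
    nlinarith
  have t4 : ((m : ℤ) + 3) ≤ (((d + q ^ (m + 4) - 1) / q ^ (m + 4) : ℕ) : ℤ) := by
    apply le_ceil_term _ _ _ hq0
    rw [hd]
    have h3 : 5 * (q : ℤ) ^ (m + 3) ≤ (q : ℤ) ^ (m + 4) := by
      have : (q : ℤ) ^ (m + 4) = q * (q : ℤ) ^ (m + 3) := by ring
      rw [this]
      exact mul_le_mul_of_nonneg_right hq' (by positivity)
    nlinarith
  have hg : ((griesmer q (m + 5) d : ℕ) : ℤ) ≥ d + (A * (q : ℤ) ^ (m + 1) - a) +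
      A * (∑ j ∈ Finset.range (m + 1), (q : ℤ) ^ j) + (((m : ℤ) + 3) * q - 4) + (m + 3) := by
    unfold griesmer
    rw [show m + 5 = (m + 1 + 1 + 1) + 1 + 1 from rfl, Finset.sum_range_succ,
      Finset.sum_range_succ, Finset.sum_range_succ', Finset.sum_range_succ',
      ← Finset.sum_range_reflect (fun j => (q : ℤ) ^ j), Finset.mul_sum]
    have := Finset.sum_le_sum tm
    simp only [Nat.cast_add, Nat.cast_sum]
    have e3 : m + 1 + 1 + 1 = m + 3 := rfl
    have e4 : m + 1 + 1 + 1 + 1 = m + 4 := rfl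
    rw [e3, zero_add]
    rw [show m + 3 + 1 = m + 4 from rfl]
    linarith
  have hgeo := mul_geom_sum (q : ℤ) (m + 1)
  have h5 := mul_le_mul_of_nonneg_left hg (show (0 : ℤ) ≤ (q : ℤ) - 1 by linarith)
  have h6 : ((q : ℤ) - 1) * (A * (∑ j ∈ Finset.range (m + 1), (q : ℤ) ^ j)) =
      A * ((q : ℤ) ^ (m + 1) - 1) := by rw [← hgeo]; ring
  have h7 : ((q : ℤ) - 1) * ((griesmer q (m + 5) d : ℕ) + b) ≥
      ((q : ℤ) - 1) * (d + b + (A * (q : ℤ) ^ (m + 1) - a) + (((m : ℤ) + 3) * q - 4) + (m + 3)) +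
      A * ((q : ℤ) ^ (m + 1) - 1) := by
    rw [← h6]; linarith
  refine le_trans (le_of_eq ?_) h7
  rw [hd, hA]
  ring

lemma poly_count {F : Type} [Field F] [Fintype F] [DecidableEq F] (m : ℕ) (y : Polynomial F)
    (hy : y ≠ 0) (hdeg : y ∈ Polynomial.degreeLT F (m + 3)) :
    (if y.coeff 0 = 0 then 1 else 0) + (if y.coeff (m + 2) = 0 then 1 else 0)
      + (Finset.univ.filter (fun t : Fˣ => y.eval (t : F) = 0)).card ≤ m + 2 := by
  classical
  have h1 : (if y.coeff 0 = 0 then 1 else 0)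
      + (Finset.univ.filter (fun t : Fˣ => y.eval (t : F) = 0)).card ≤ y.natDegree := by
    refine le_trans ?_ (y.card_roots')
    refine le_trans ?_ (Multiset.toFinset_card_le _)
    have hc : (Finset.univ.filter (fun t : Fˣ => y.eval (t : F) = 0)).card =
      ((Finset.univ.filter (fun t : Fˣ => y.eval (t : F) = 0)).image (fun t : Fˣ => (t : F))).card :=
      (Finset.card_image_of_injective _ Units.val_injective).symm
    rw [hc]
    split_ifs with h0
    · rw [add_comm, ← Finset.card_insert_of_notMem (a := (0 : F)) (by simp)]
      apply Finset.card_le_card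
      intro x hx
      rw [Multiset.mem_toFinset, Polynomial.mem_roots hy, Polynomial.IsRoot.def]
      rcases Finset.mem_insert.1 hx with rfl | hx
      · rwa [← Polynomial.coeff_zero_eq_eval_zero]
      · simp only [Finset.mem_image, Finset.mem_filter] at hx
        obtain ⟨t, ht, rfl⟩ := hx
        exact ht.2
    · rw [zero_add]
      apply Finset.card_le_card
      intro x hx
      rw [Multiset.mem_toFinset, Polynomial.mem_roots hy, Polynomial.IsRoot.def]
      simp only [Finset.mem_image, Finset.mem_filter] at hx
      obtain ⟨t, ht, rfl⟩ := hx
      exact ht.2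
  rw [Polynomial.mem_degreeLT] at hdeg
  have h2 : y.natDegree < m + 3 := (Polynomial.natDegree_lt_iff_degree_lt hy).2 hdeg
  have h3 : y.coeff (m + 2) = 0 → y.natDegree ≠ m + 2 := by
    intro h h'
    rw [← h'] at h
    exact hy (Polynomial.leadingCoeff_eq_zero.1 h)
  by_cases hc : y.coeff (m + 2) = 0
  · have := h3 hc
    rw [if_pos hc]; omega
  · rw [if_neg hc]; omega

lemma split_sum {V T1 T2 : Type} [Fintype V] (S1 : Finset T1) (S2 : Finset T2) (c : ℤ)
    (L p : V → Prop) (H : Fin 4 → V → Prop) (G : T1 → V → Prop) (M : T2 → V → Prop)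
    [DecidablePred L] [DecidablePred p] [∀ i, DecidablePred (H i)] [∀ i, DecidablePred (G i)]
    [∀ i, DecidablePred (M i)] :
    (∑ v, if p v then (c + (if L v then 1 else 0) - (∑ i, if H i v then 1 else 0)
      - (∑ t ∈ S1, if G t v then 1 else 0) - (∑ s ∈ S2, if M s v then 1 else 0)) else 0) =
    c * (∑ v, if p v then 1 else 0) + (∑ v, if L v ∧ p v then 1 else 0)
      - (∑ i, ∑ v, if H i v ∧ p v then 1 else 0)
      - (∑ t ∈ S1, ∑ v, if G t v ∧ p v then 1 else 0)
      - (∑ s ∈ S2, ∑ v, if M s v ∧ p v then 1 else 0) := by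
  rw [Finset.sum_comm (s := Finset.univ (α := Fin 4)), Finset.sum_comm (s := S1),
    Finset.sum_comm (s := S2), Finset.mul_sum, ← Finset.sum_add_distrib,
    ← Finset.sum_sub_distrib, ← Finset.sum_sub_distrib, ← Finset.sum_sub_distrib]
  refine Finset.sum_congr rfl fun v _ => ?_
  by_cases h : p v <;> simp [h]

lemma sum_le_drop {T : Type} [DecidableEq T] (S : Finset T) (f : T → ℤ) (B : ℤ)
    (hf : ∀ i ∈ S, f i ≤ B) (j : T) (hj : j ∈ S) (h0 : f j = 0) :
    ∑ i ∈ S, f i ≤ ((S.card : ℤ) - 1) * B := by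
  rw [← Finset.add_sum_erase _ _ hj, h0, zero_add]
  have := Finset.sum_le_card_nsmul (S.erase j) f B (fun i hi => hf i (Finset.mem_of_mem_erase hi))
  rw [Finset.card_erase_of_mem hj, nsmul_eq_mul,
    Nat.cast_sub (Finset.card_pos.2 ⟨j, hj⟩)] at this
  simpa using this

open Polynomial in
lemma main_construction (F : Type) [Field F] [Fintype F] [DecidableEq F] (m a : ℕ)
    (ha : a ≤ Fintype.card F - 1) (D b n d : ℕ)
    (hD : (D : ℤ) ≤ ((m : ℤ) + 3) * (Fintype.card F : ℤ) ^ (m + 4)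
      - 5 * (Fintype.card F : ℤ) ^ (m + 3)
      + 2 * (Fintype.card F : ℤ) ^ (m + 2) - a * (Fintype.card F : ℤ))
    (hN : ((m : ℤ) + 3) * ((Fintype.card F : ℤ) ^ (m + 5) - 1)
      + ((Fintype.card F : ℤ) ^ (m + 3) - 1)
      - 4 * ((Fintype.card F : ℤ) ^ (m + 4) - 1)
      - ((Fintype.card F : ℤ) - 1) * ((Fintype.card F : ℤ) ^ (m + 3) - 1)
      - a * ((Fintype.card F : ℤ) ^ 2 - 1) ≤ ((Fintype.card F : ℤ) - 1) * (n + b))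
    (hd : d + b ≤ D) (hd1 : 1 ≤ d) :
    ∃ C : Submodule F (Fin n → F), IsLinearCodeWith F n (m + 5) d C := by
  classical
  have hq : (0 : ℤ) < (Fintype.card F : ℤ) - 1 := by
    have := Fintype.one_lt_card (α := F); omega
  let Y := degreeLT F (m + 3)
  let V := (F × F) × Y
  have hYfin : Module.Finite F Y := Module.Finite.equiv (degreeLTEquiv F (m + 3)).symm
  have hYr : Module.finrank F Y = m + 3 := by
    rw [(degreeLTEquiv F (m + 3)).finrank_eq]; simp
  have hVfin : Module.Finite F V := inferInstance
  have hVr : Module.finrank F V = m + 5 := by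
    simp only [V, Module.finrank_prod, hYr, Module.finrank_self]; omega
  have : Finite V := Module.finite_of_finite F
  let _ : Fintype V := Fintype.ofFinite V
  let x0 : V →ₗ[F] F := LinearMap.fst F F F ∘ₗ LinearMap.fst F (F × F) Y
  let x1 : V →ₗ[F] F := LinearMap.snd F F F ∘ₗ LinearMap.fst F (F × F) Y
  let yy : V →ₗ[F] F[X] := Y.subtype ∘ₗ LinearMap.snd F (F × F) Y
  let y0 : V →ₗ[F] F := lcoeff F 0 ∘ₗ yy
  let yl : V →ₗ[F] F := lcoeff F (m + 2) ∘ₗ yy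
  let ev : F → (V →ₗ[F] F) := fun t => leval t ∘ₗ yy
  have hmono : ∀ (c : F) (i : ℕ), i < m + 3 → monomial i c ∈ degreeLT F (m + 3) := by
    intro c i hi
    rw [mem_degreeLT]
    exact lt_of_le_of_lt (degree_monomial_le _ _) (by exact_mod_cast hi)
  let c0 : F →ₗ[F] Y := (monomial 0).codRestrict Y (fun c => hmono c 0 (by omega))
  let cl : F →ₗ[F] Y := (monomial (m + 2)).codRestrict Y (fun c => hmono c _ (by omega))
  let h : Fin 4 → (V →ₗ[F] F) := ![x0, x1, y0, yl]
  let H : Fin 4 → Submodule F V := fun i => LinearMap.ker (h i)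
  let G : Fˣ → Submodule F V := fun t => LinearMap.ker ((x0 + (t : F) • x1).prod (ev t))
  let L : Submodule F V := LinearMap.ker (x0.prod x1)
  let M' : Fˣ → (F × F →ₗ[F] V) := fun s => LinearMap.id.prod
    ((s : F) • (c0 ∘ₗ LinearMap.fst F F F + cl ∘ₗ LinearMap.snd F F F))
  let M : Fˣ → Submodule F V := fun s => LinearMap.range (M' s)
  obtain ⟨S, -, hS⟩ : ∃ S ⊆ (Finset.univ : Finset Fˣ), S.card = a := by
    apply Finset.exists_subset_card_eq
    rw [Finset.card_univ, Fintype.card_units]; exact ha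
  -- membership
  have mG : ∀ t v, v ∈ G t ↔ v.1.1 + t * v.1.2 = 0 ∧ (v.2 : F[X]).eval (t : F) = 0 := by
    intro t v
    simp [G, x0, x1, ev, yy, leval_apply]
    rfl
  have mL : ∀ v, v ∈ L ↔ v.1.1 = 0 ∧ v.1.2 = 0 := by
    intro v
    simp [L, x0, x1]
    rfl
  have mH0 : ∀ v, v ∈ H 0 ↔ v.1.1 = 0 := by intro v; simp [H, h, x0]; rfl
  have mH1 : ∀ v, v ∈ H 1 ↔ v.1.2 = 0 := by intro v; simp [H, h, x1]; rfl
  have mH2 : ∀ v, v ∈ H 2 ↔ (v.2 : F[X]).coeff 0 = 0 := by intro v; simp [H, h, y0, yy]; rfl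
  have mH3 : ∀ v, v ∈ H 3 ↔ (v.2 : F[X]).coeff (m + 2) = 0 := by
    intro v; simp [H, h, yl, yy]; rfl
  have mM : ∀ s v, v ∈ M s → v.2 = (s : F) • (c0 v.1.1 + cl v.1.2) := by
    rintro s v ⟨w, rfl⟩
    rfl
  have mM0 : ∀ s v, v ∈ M s → (v.2 : F[X]).coeff 0 = s * v.1.1 := by
    intro s v hv
    rw [mM s v hv]
    simp [c0, cl, coeff_monomial]
  have mMl : ∀ s v, v ∈ M s → (v.2 : F[X]).coeff (m + 2) = s * v.1.2 := by
    intro s v hv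
    rw [mM s v hv]
    simp [c0, cl, coeff_monomial]
  -- dimensions
  have dH : ∀ i, Module.finrank F (H i) = m + 3 + 1 := by
    intro i
    have hne : h i ≠ 0 := by
      intro h0
      have hall : ∀ v, v ∈ H i := by
        intro v
        change h i v = 0
        rw [h0]; rfl
      fin_cases i
      · exact one_ne_zero ((mH0 (((1, 0), 0) : V)).1 (hall _))
      · exact one_ne_zero ((mH1 (((0, 1), 0) : V)).1 (hall _))
      · have := (mH2 (((0, 0), c0 1) : V)).1 (hall _)
        change (monomial 0 (1 : F)).coeff 0 = 0 at this
        simp at this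
      · have := (mH3 (((0, 0), cl 1) : V)).1 (hall _)
        change (monomial (m + 2) (1 : F)).coeff (m + 2) = 0 at this
        simp at this
    have := Module.Dual.finrank_ker_add_one_of_ne_zero (f := h i) hne
    change Module.finrank F (LinearMap.ker (h i)) = _
    omega
  have dker : ∀ f : V →ₗ[F] F × F, Function.Surjective f →
      Module.finrank F (LinearMap.ker f) = m + 2 + 1 := by
    intro f hf
    have h1 := f.finrank_range_add_finrank_ker
    rw [LinearMap.range_eq_top.2 hf, finrank_top, hVr] at h1
    simp only [Module.finrank_prod, Module.finrank_self] at h1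
    omega
  have dG : ∀ t, Module.finrank F (G t) = m + 2 + 1 := by
    intro t
    apply dker
    rintro ⟨u, w⟩
    refine ⟨((u, 0), c0 w), Prod.ext ?_ ?_⟩
    · change u + (t : F) * 0 = u
      simp
    · change eval (t : F) (monomial 0 w) = w
      simp
  have dL : Module.finrank F L = m + 2 + 1 := by
    apply dker
    rintro ⟨u, w⟩
    exact ⟨((u, w), 0), rfl⟩
  have dM : ∀ s, Module.finrank F (M s) = 1 + 1 := by
    intro s
    rw [LinearMap.finrank_range_of_inj]
    · simp [Module.finrank_prod]
    · intro u w huw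
      exact congrArg Prod.fst huw
  have dT : Module.finrank F (⊤ : Submodule F V) = m + 4 + 1 := by
    rw [finrank_top, hVr]
  let mu : V → ℤ := fun v => ((m : ℤ) + 3) + (if v ∈ L then 1 else 0)
      - (∑ i, if v ∈ H i then 1 else 0)
      - (∑ t ∈ (Finset.univ : Finset Fˣ), if v ∈ G t then 1 else 0)
      - (∑ s ∈ S, if v ∈ M s then 1 else 0)
  have hcardU : ((Finset.univ : Finset Fˣ).card : ℤ) = (Fintype.card F : ℤ) - 1 := by
    rw [Finset.card_univ, Fintype.card_units, Nat.cast_sub Fintype.card_pos]; simp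
  refine exists_code_mult hVr (by omega) mu ?_ ?_ D b n d ?_ ?_ hd hd1
  · -- nonnegativity
    intro v hv
    simp only [mu, Fin.sum_univ_four]
    simp only [mL, mG, mH0, mH1, mH2, mH3, Finset.sum_boole]
    by_cases hx : v.1.1 = 0 ∧ v.1.2 = 0
    · have hy : (v.2 : F[X]) ≠ 0 := by
        intro h0
        apply hv
        refine Prod.ext (Prod.ext hx.1 hx.2) (Subtype.ext h0)
      have hp := poly_count m (v.2 : F[X]) hy v.2.2
      have hMe : (S.filter (fun s => v ∈ M s)).card = 0 := by
        rw [Finset.card_eq_zero, Finset.filter_eq_empty_iff]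
        intro s _ hs
        apply hy
        rw [mM s v hs, hx.1, hx.2]
        simp
      rw [hMe]
      simp only [hx.1, hx.2, mul_zero, add_zero, true_and, if_true, and_self]
      rw [← Nat.cast_le (α := ℤ)] at hp
      push_cast at hp ⊢
      linarith only [hp]
    · have h1 : ((if v.1.1 = 0 then 1 else 0) + (if v.1.2 = 0 then 1 else 0) +
          (Finset.univ.filter (fun t : Fˣ => v.1.1 + t * v.1.2 = 0 ∧
            (v.2 : F[X]).eval (t : F) = 0)).card : ℤ) ≤ 1 := by
        by_cases h0 : v.1.1 = 0
        · have h1 : v.1.2 ≠ 0 := fun h => hx ⟨h0, h⟩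
          simp [h0, h1]
        · by_cases h1 : v.1.2 = 0
          · simp [h0, h1]
          · simp only [h0, h1, if_false, zero_add]
            norm_cast
            rw [Finset.card_le_one]
            intro t ht s hs
            simp only [Finset.mem_filter] at ht hs
            apply Units.ext
            apply mul_right_cancel₀ h1
            linear_combination ht.2.1 - hs.2.1
      have h2 : ((if (v.2 : F[X]).coeff 0 = 0 then 1 else 0) +
          (if (v.2 : F[X]).coeff (m + 2) = 0 then 1 else 0) +
          (S.filter (fun s => v ∈ M s)).card : ℤ) ≤ 2 := by
        by_cases hs : ∃ s, v ∈ M s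
        · obtain ⟨s, hs⟩ := hs
          have hc : (S.filter (fun s => v ∈ M s)).card ≤ 1 := by
            rw [Finset.card_le_one]
            intro t ht r hr
            simp only [Finset.mem_filter] at ht hr
            apply Units.ext
            have a1 := mM0 _ _ ht.2
            have a2 := mM0 _ _ hr.2
            have b1 := mMl _ _ ht.2
            have b2 := mMl _ _ hr.2
            by_cases h0 : v.1.1 = 0
            · have h1 : v.1.2 ≠ 0 := fun h => hx ⟨h0, h⟩
              exact mul_right_cancel₀ h1 (b1.symm.trans b2)
            · exact mul_right_cancel₀ h0 (a1.symm.trans a2)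
          have hc' : ((S.filter (fun s => v ∈ M s)).card : ℤ) ≤ 1 := by exact_mod_cast hc
          have a1 := mM0 _ _ hs
          have b1 := mMl _ _ hs
          by_cases h0 : v.1.1 = 0
          · have h1 : v.1.2 ≠ 0 := fun h => hx ⟨h0, h⟩
            have : (v.2 : F[X]).coeff (m + 2) ≠ 0 := by rw [b1]; simp [h1]
            rw [if_neg this]
            split_ifs <;> linarith
          · have : (v.2 : F[X]).coeff 0 ≠ 0 := by rw [a1]; simp [h0]
            rw [if_neg this]
            split_ifs <;> linarith
        · push Not at hs
          have hMe : (S.filter (fun s => v ∈ M s)).card = 0 := by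
            rw [Finset.card_eq_zero, Finset.filter_eq_empty_iff]
            intro s _; exact hs s
          rw [hMe]
          split_ifs <;> simp
      rw [if_neg hx]
      have : (0 : ℤ) ≤ m := by positivity
      linarith
  · intro c v hc
    simp only [mu, Submodule.smul_mem_iff _ hc]
  · -- weights
    intro φ hφ
    have hsp := split_sum (Finset.univ : Finset Fˣ) S ((m : ℤ) + 3) (fun v : V => v ∈ L)
      (fun v : V => φ v ≠ 0) (fun i v => v ∈ H i) (fun t v => v ∈ G t) (fun s v => v ∈ M s)
    refine le_trans ?_ (le_of_eq hsp.symm)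
    have cT : (∑ v : V, if φ v ≠ 0 then (1 : ℤ) else 0) =
        ((Fintype.card F : ℤ) - 1) * (Fintype.card F : ℤ) ^ (m + 4) := by
      have hex : ∃ v ∈ (⊤ : Submodule F V), φ v ≠ 0 := by
        by_contra hcon
        push Not at hcon
        exact hφ (LinearMap.ext fun v => hcon v trivial)
      have := card_sub_phi (⊤ : Submodule F V) _ dT φ hex
      simpa using this
    have cH : ∀ i ∈ Finset.univ, _ := fun i (_ : i ∈ Finset.univ) =>
      card_sub_phi_le (H i) _ (dH i) φ
    have cG : ∀ t ∈ Finset.univ, _ := fun t (_ : t ∈ Finset.univ) =>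
      card_sub_phi_le (G t) _ (dG t) φ
    have cM : ∀ s ∈ S, _ := fun s (_ : s ∈ S) => card_sub_phi_le (M s) _ (dM s) φ
    have sH := Finset.sum_le_card_nsmul _ _ _ cH
    have sG := Finset.sum_le_card_nsmul _ _ _ cG
    have sM := Finset.sum_le_card_nsmul _ _ _ cM
    rw [nsmul_eq_mul] at sH sG sM
    rw [hcardU] at sG
    rw [hS] at sM
    rw [cT]
    simp only [Finset.card_univ, Fintype.card_fin] at sH
    have hDm := mul_le_mul_of_nonneg_left hD hq.le
    set Q : ℤ := (Fintype.card F : ℤ) with hQdef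
    have hQ1 : 1 ≤ Q := by linarith
    have hp2 : 0 ≤ (Q - 1) * Q ^ (m + 2) := by positivity
    have hp3 : (Q - 1) * Q ^ (m + 2) ≤ (Q - 1) * Q ^ (m + 3) := by
      apply mul_le_mul_of_nonneg_left _ hq.le
      exact pow_le_pow_right₀ hQ1 (by omega)
    refine hDm.trans ?_
    have key : (Q - 1) * (((m : ℤ) + 3) * Q ^ (m + 4) - 5 * Q ^ (m + 3) + 2 * Q ^ (m + 2) - a * Q)
        = ((m : ℤ) + 3) * ((Q - 1) * Q ^ (m + 4)) + (Q - 1) * Q ^ (m + 2)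
          - 4 * ((Q - 1) * Q ^ (m + 3)) - (Q - 1) * ((Q - 1) * Q ^ (m + 2))
          - a * ((Q - 1) * Q ^ 1) := by ring
    rw [key]
    push_cast at sH
    by_cases hL : ∃ v ∈ L, φ v ≠ 0
    · have cL := card_sub_phi L _ dL φ hL
      rw [cL]
      linarith
    · push Not at hL
      have cL : (0 : ℤ) ≤ ∑ v : V, if v ∈ L ∧ φ v ≠ 0 then (1 : ℤ) else 0 := by
        apply Finset.sum_nonneg; intro v _; split_ifs <;> simp
      have zero_of : ∀ U : Submodule F V, (∀ v ∈ U, φ v = 0) →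
          (∑ v : V, if v ∈ U ∧ φ v ≠ 0 then (1 : ℤ) else 0) = 0 := by
        intro U hU
        apply Finset.sum_eq_zero
        intro v _
        rw [if_neg]
        rintro ⟨p, r⟩
        exact r (hU v p)
      have hform : ∀ v : V, φ v = v.1.1 * φ ((1, 0), 0) + v.1.2 * φ ((0, 1), 0) := by
        intro v
        have e : v = v.1.1 • (((1, 0), 0) : V) + v.1.2 • (((0, 1), 0) : V)
            + (((0, 0), v.2) : V) := by
          refine Prod.ext (Prod.ext ?_ ?_) ?_ <;> simp
        have e2 : φ ((0, 0), v.2) = 0 := hL _ ((mL _).2 ⟨rfl, rfl⟩)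
        conv_lhs => rw [e]
        rw [map_add, map_add, map_smul, map_smul, e2]
        simp
      by_cases hα : φ ((1, 0), 0) = 0
      · have hz := zero_of (H 1) (by
          intro v hv
          rw [hform, hα, (mH1 v).1 hv]; simp)
        have := sum_le_drop _ _ _ cH 1 (Finset.mem_univ _) hz
        simp only [Finset.card_univ, Fintype.card_fin] at this
        push_cast at this
        linarith
      · by_cases hβ : φ ((0, 1), 0) = 0
        · have hz := zero_of (H 0) (by
            intro v hv
            rw [hform, hβ, (mH0 v).1 hv]; simp)
          have := sum_le_drop _ _ _ cH 0 (Finset.mem_univ _) hz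
          simp only [Finset.card_univ, Fintype.card_fin] at this
          push_cast at this
          linarith
        · let t : Fˣ := Units.mk0 (φ ((0, 1), 0) / φ ((1, 0), 0)) (div_ne_zero hβ hα)
          have hz := zero_of (G t) (by
            intro v hv
            have h1 := ((mG t v).1 hv).1
            have h2 : (t : F) * φ ((1, 0), 0) = φ ((0, 1), 0) := by
              simp only [t, Units.val_mk0]; field_simp
            rw [hform, ← h2]
            linear_combination φ ((1, 0), 0) * h1)
          have := sum_le_drop _ _ _ cG t (Finset.mem_univ _) hz
          rw [hcardU] at this
          linarith
  · -- length
    have hsp := split_sum (Finset.univ : Finset Fˣ) S ((m : ℤ) + 3) (fun v : V => v ∈ L)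
      (fun v : V => v ≠ 0) (fun i v => v ∈ H i) (fun t v => v ∈ G t) (fun s v => v ∈ M s)
    refine le_trans (le_of_eq hsp) (le_trans (le_of_eq ?_) hN)
    have cT := card_sub_ne (⊤ : Submodule F V) _ dT
    simp only [Submodule.mem_top, true_and] at cT
    rw [cT, card_sub_ne L _ dL,
      Finset.sum_congr rfl (fun i _ => card_sub_ne (H i) _ (dH i)),
      Finset.sum_congr rfl (fun i _ => card_sub_ne (G i) _ (dG i)),
      Finset.sum_congr rfl (fun i _ => card_sub_ne (M i) _ (dM i))]
    simp only [Finset.sum_const, nsmul_eq_mul, hcardU, hS]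
    simp

/-- For every integer `k ≥ 5`, every prime power `q ≥ max {5, k - 2}` and every `d` with
`(k-2)q^{k-1} - 5q^{k-2} + 2q^{k-3} - q² + q ≤ d ≤ (k-2)q^{k-1} - 5q^{k-2} + 2q^{k-3}`
there exists a Griesmer `[g_q(k,d), k, d]_q` code. -/
theorem statement1 (k q d : ℕ) (hk : 5 ≤ k) (hq : IsPrimePow q) (hkq : max 5 (k - 2) ≤ q)
    (hd1 : ((k : ℤ) - 2) * (q : ℤ) ^ (k - 1) - 5 * (q : ℤ) ^ (k - 2) + 2 * (q : ℤ) ^ (k - 3)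
      - (q : ℤ) ^ 2 + (q : ℤ) ≤ (d : ℤ))
    (hd2 : (d : ℤ) ≤ ((k : ℤ) - 2) * (q : ℤ) ^ (k - 1) - 5 * (q : ℤ) ^ (k - 2)
      + 2 * (q : ℤ) ^ (k - 3))
    (F : Type) [Field F] [Fintype F] [DecidableEq F] (hF : Fintype.card F = q) :
    ∃ C : Submodule F (Fin (griesmer q k d) → F),
      IsLinearCodeWith F (griesmer q k d) k d C := by
  subst hF
  obtain ⟨m, rfl⟩ : ∃ m, k = m + 5 := ⟨k - 5, by omega⟩
  set q := Fintype.card F with hqdef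
  have hq5 : 5 ≤ q := le_trans (le_max_left _ _) hkq
  have hq5' : (5 : ℤ) ≤ q := by exact_mod_cast hq5
  have s1 : m + 5 - 1 = m + 4 := by omega
  have s2 : m + 5 - 2 = m + 3 := by omega
  have s3 : m + 5 - 3 = m + 2 := by omega
  rw [s1, s2, s3] at hd1 hd2
  push_cast at hd1 hd2
  obtain ⟨e, he⟩ : ∃ e : ℕ, (e : ℤ) = ((m : ℤ) + 3) * (q : ℤ) ^ (m + 4)
      - 5 * (q : ℤ) ^ (m + 3) + 2 * (q : ℤ) ^ (m + 2) - d :=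
    ⟨(((m : ℤ) + 3) * (q : ℤ) ^ (m + 4)
      - 5 * (q : ℤ) ^ (m + 3) + 2 * (q : ℤ) ^ (m + 2) - d).toNat,
      Int.toNat_of_nonneg (by linarith)⟩
  have hedm : (q : ℤ) * (e / q : ℕ) + (e % q : ℕ) = e := by exact_mod_cast Nat.div_add_mod e q
  have hele : (e : ℤ) ≤ (q : ℤ) ^ 2 - q := by linarith
  have hb : e % q < q := Nat.mod_lt _ (by omega)
  have ha : e / q ≤ q - 1 := by
    apply Nat.div_le_of_le_mul
    zify [show 1 ≤ q by omega]
    linarith [sq (q : ℤ)]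
  have hdd : (d : ℤ) = ((m : ℤ) + 3) * (q : ℤ) ^ (m + 4) - 5 * (q : ℤ) ^ (m + 3)
      + 2 * (q : ℤ) ^ (m + 2) - (e / q : ℕ) * q - (e % q : ℕ) := by linarith
  have hdpos : 1 ≤ d := by
    have h3 : 5 * (q : ℤ) ^ (m + 3) ≤ (q : ℤ) ^ (m + 4) := by
      have : (q : ℤ) ^ (m + 4) = q * (q : ℤ) ^ (m + 3) := by ring
      rw [this]
      exact mul_le_mul_of_nonneg_right hq5' (by positivity)
    have h4 : (q : ℤ) ^ 2 ≤ (q : ℤ) ^ (m + 2) := pow_le_pow_right₀ (by linarith) (by omega)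
    have h5 : (0 : ℤ) ≤ m * (q : ℤ) ^ (m + 4) := by positivity
    have h6 : (0 : ℤ) ≤ (q : ℤ) ^ (m + 3) := by positivity
    zify
    nlinarith
  refine main_construction F m (e / q) ha (d + e % q) (e % q) (griesmer q (m + 5) d) d ?_ ?_
    le_rfl hdpos
  · rw [← hqdef]; push_cast; push_cast at hdd; linarith
  · exact griesmer_lower m q (e / q) (e % q) d hq5 hb (by linarith) hdd
end

section
/- For every prime power q ≥ 3 and every integer d satisfying 2q⁴ − 3q³ + q ≤ d ≤ 2q⁴ − 3q³ + q², there exists an [g_q(5,d), 5, d]_q linear code. -/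
open Finset in
lemma card_zero_mul {F V : Type} [Field F] [Fintype F] [DecidableEq F] [AddCommGroup V] [Module F V]
    [Fintype V] (f : V →ₗ[F] F) (hf : f ≠ 0) :
    #{v : V | f v = 0} * Fintype.card F = Fintype.card V := by
  classical
  obtain ⟨w, hw⟩ : ∃ w, f w ≠ 0 := by
    by_contra! h
    exact hf (LinearMap.ext h)
  let e : {v : V // f v = 0} × F ≃ V :=
    { toFun := fun p => p.1.1 + p.2 • w
      invFun := fun v => (⟨v - (f v / f w) • w, by simp [hw]⟩, f v / f w)
      left_inv := by
        rintro ⟨⟨v, hv⟩, c⟩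
        simp [hv, hw]
      right_inv := by
        intro v
        simp }
  rw [← Fintype.card_congr e, Fintype.card_prod, Fintype.card_subtype]

open Finset in
lemma card_ne_mul {F V : Type} [Field F] [Fintype F] [DecidableEq F] [AddCommGroup V] [Module F V]
    [Fintype V] (f : V →ₗ[F] F) :
    #{v : V | f v ≠ 0} * Fintype.card F ≤ Fintype.card V * (Fintype.card F - 1) := by
  classical
  by_cases hf : f = 0
  · simp [hf]
  · have h1 := card_zero_mul f hf
    have h2 := Finset.card_filter_add_card_filter_not (s := (univ : Finset V)) (fun v => f v = 0)
    rw [card_univ] at h2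
    apply le_of_eq
    obtain ⟨r, hr⟩ : ∃ r, Fintype.card F = r + 1 := ⟨Fintype.card F - 1, by
      have := Fintype.card_pos (α := F); omega⟩
    simp only [hr] at *
    simp only [Nat.add_sub_cancel]
    have h3 : #{v : V | f v ≠ 0} = #{v : V | f v = 0} * r := by
      have : #{v : V | f v ≠ 0} = #{v : V | ¬ f v = 0} := rfl
      rw [← h1] at h2
      rw [this]; linarith
    rw [h3, ← h1]; ring

open Finset in
lemma card_ne_and_mul {F V : Type} [Field F] [Fintype F] [DecidableEq F] [AddCommGroup V]
    [Module F V] [Fintype V] (f g : V →ₗ[F] F) (hg : g ≠ 0) :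
    #{v : V | f v ≠ 0 ∧ g v = 0} * (Fintype.card F) ^ 2 ≤ Fintype.card V * (Fintype.card F - 1) := by
  classical
  have h1 := card_zero_mul g hg
  have h2 := card_ne_mul (f.comp (LinearMap.ker g).subtype)
  have h3 : #{v : LinearMap.ker g | (f.comp (LinearMap.ker g).subtype) v ≠ 0}
      = #{v : V | f v ≠ 0 ∧ g v = 0} := by
    apply Finset.card_bij (fun v _ => v.1)
    · intro a ha
      have := a.2
      simp only [LinearMap.mem_ker] at this
      simp only [mem_filter, mem_univ, true_and] at ha ⊢
      exact ⟨ha, this⟩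
    · intro a _ b _ h
      exact Subtype.ext h
    · intro b hb
      simp only [mem_filter, mem_univ, true_and] at hb
      exact ⟨⟨b, by simpa using hb.2⟩, by simp only [mem_filter, mem_univ, true_and]; exact hb.1, rfl⟩
  have h4 : Fintype.card (LinearMap.ker g) = #{v : V | g v = 0} := by
    rw [← Fintype.card_subtype]
    exact Fintype.card_congr (Equiv.subtypeEquivRight (fun _ => by simp))
  rw [h3, h4] at h2
  calc _ = (#{v : V | f v ≠ 0 ∧ g v = 0} * (Fintype.card F)) * Fintype.card F := by ring
    _ ≤ (#{v : V | g v = 0} * (Fintype.card F - 1)) * Fintype.card F := Nat.mul_le_mul_right _ h2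
    _ = _ := by rw [← h1]; ring

open Finset in
lemma sum_rep {F V : Type} [Field F] [Fintype F] [DecidableEq F] [AddCommGroup V] [Module F V]
    [Fintype V] [Fintype (Projectivization F V)] (f : V → ℕ)
    (hf0 : f 0 = 0) (hf : ∀ (c : F) (v : V), c ≠ 0 → f (c • v) = f v) :
    ∑ v, f v = (Fintype.card F - 1) * ∑ P : Projectivization F V, f P.rep := by
  classical
  have h1 : ∑ v, f v = ∑ v : {v : V // v ≠ 0}, f v.1 := by
    rw [← Finset.sum_subtype (univ.filter (fun v : V => v ≠ 0)) (by simp) f, Finset.sum_filter]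
    apply Finset.sum_congr rfl
    intro v _
    by_cases h : v = 0 <;> simp [h, hf0]
  let g : Fˣ × Projectivization F V → {v : V // v ≠ 0} := fun p =>
    ⟨(p.1 : F) • p.2.rep, smul_ne_zero p.1.ne_zero p.2.rep_nonzero⟩
  have hg : Function.Bijective g := by
    constructor
    · rintro ⟨c, P⟩ ⟨d, Q⟩ h
      have h' : (c : F) • P.rep = (d : F) • Q.rep := congrArg Subtype.val h
      have hPQ : P = Q := by
        rw [← P.mk_rep, ← Q.mk_rep, Projectivization.mk_eq_mk_iff']
        refine ⟨(c : F)⁻¹ * d, ?_⟩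
        rw [mul_smul, ← h', smul_smul, inv_mul_cancel₀ c.ne_zero, one_smul]
      subst hPQ
      have := smul_left_injective F P.rep_nonzero h'
      rw [Units.ext this]
    · rintro ⟨v, hv⟩
      obtain ⟨a, ha⟩ := Projectivization.exists_smul_eq_mk_rep F v hv
      refine ⟨(a⁻¹, Projectivization.mk F v hv), ?_⟩
      apply Subtype.ext
      change ((a⁻¹ : Fˣ) : F) • (Projectivization.mk F v hv).rep = v
      rw [← ha, ← Units.smul_def, smul_smul]; simp
  rw [h1, ← Function.Bijective.sum_comp hg (fun v => f v.1), Fintype.sum_prod_type]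
  simp only [g]
  rw [Finset.sum_congr rfl (fun (c : Fˣ) _ => Finset.sum_congr rfl
    (fun P _ => hf c (Projectivization.rep P) c.ne_zero))]
  simp [Fintype.card_units]

/-- From a family of vectors with all weights `≥ d` get an exact code. -/
lemma exact_code {F : Type} [Field F] [DecidableEq F] (n d : ℕ) (hd : 1 ≤ d)
    (v : Fin n → (Fin 5 → F))
    (hv : ∀ b : Module.Dual F (Fin 5 → F), b ≠ 0 → d ≤ hammingNorm (fun i => b (v i))) :
    ∃ C : Submodule F (Fin n → F), IsLinearCodeWith F n 5 d C := by
  classical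
  have key : ∀ (N : ℕ) (v : Fin n → (Fin 5 → F)), (Finset.univ.filter (fun i => v i ≠ 0)).card = N →
    (∀ b : Module.Dual F (Fin 5 → F), b ≠ 0 → d ≤ hammingNorm (fun i => b (v i))) →
    ∃ v : Fin n → (Fin 5 → F), 
    (∀ b : Module.Dual F (Fin 5 → F), b ≠ 0 → d ≤ hammingNorm (fun i => b (v i))) ∧
    ∃ b : Module.Dual F (Fin 5 → F), b ≠ 0 ∧ hammingNorm (fun i => b (v i)) = d := by
    intro N
    induction N using Nat.strong_induction_on with
    | _ N ih =>
    intro v hN hv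
    by_cases hex : ∃ b : Module.Dual F (Fin 5 → F), b ≠ 0 ∧ hammingNorm (fun i => b (v i)) = d
    · exact ⟨v, hv, hex⟩
    push Not at hex
    have hb0 : (LinearMap.proj 0 : Module.Dual F (Fin 5 → F)) ≠ 0 := by
      intro h
      have := LinearMap.congr_fun h (Pi.single 0 1)
      simp at this
    obtain ⟨i, hi⟩ : ∃ i, v i ≠ 0 := by
      by_contra! h
      have := hv _ hb0
      simp only [h, map_zero] at this
      have h2 : hammingNorm (fun _ : Fin n => (0 : F)) = 0 := hammingNorm_zero
      omega
    refine ih _ ?_ (Function.update v i 0) rfl ?_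
    · rw [← hN]
      apply Finset.card_lt_card
      rw [Finset.ssubset_iff]
      refine ⟨i, by simp, ?_⟩
      intro j hj
      simp only [Finset.mem_insert, Finset.mem_filter, Finset.mem_univ, true_and] at hj ⊢
      rcases hj with rfl | hj
      · exact hi
      · by_cases hji : j = i
        · subst hji; exact hi
        · simpa [hji] using hj
    · intro b hb
      have h1 := hv b hb
      have h2 := hex b hb
      have h3 : hammingNorm (fun j => b (v j)) ≤
          hammingNorm (fun j => b (Function.update v i 0 j)) + 1 := by
        unfold hammingNorm
        refine le_trans (Finset.card_le_card ?_) (Finset.card_insert_le i _)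
        intro j hj
        simp only [Finset.mem_insert, Finset.mem_filter, Finset.mem_univ, true_and] at hj ⊢
        by_cases hji : j = i
        · exact Or.inl hji
        · right; simpa [hji] using hj
      omega
  obtain ⟨v, hv, b, hb, hbd⟩ := key _ v rfl hv
  let T : Module.Dual F (Fin 5 → F) →ₗ[F] (Fin n → F) :=
    LinearMap.pi (fun i => Module.Dual.eval F _ (v i))
  have hT : ∀ b i, T b i = b (v i) := fun b i => rfl
  have hT' : ∀ b, T b = fun i => b (v i) := fun b => rfl
  have hT0 : ∀ b, b ≠ 0 → T b ≠ 0 := by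
    intro b hb h
    have := hv b hb
    rw [← hT', h, hammingNorm_zero] at this
    omega
  refine ⟨LinearMap.range T, ?_, ?_, ?_⟩
  · rw [LinearMap.finrank_range_of_inj, Subspace.dual_finrank_eq]
    · simp
    · rw [← LinearMap.ker_eq_bot, LinearMap.ker_eq_bot']
      intro b h
      by_contra hb
      exact hT0 b hb h
  · rintro _ ⟨b, rfl⟩ hc
    exact hv b (by rintro rfl; simp at hc)
  · exact ⟨T b, ⟨b, rfl⟩, hT0 b hb, hbd⟩

section geom
open Finset
variable {F : Type} [Field F] [Fintype F] [DecidableEq F]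

/-- the affine points of the scroll, as functionals. -/
def xfun (p : F × F) : Module.Dual F (Fin 5 → F) :=
  LinearMap.proj 0 + p.1 • LinearMap.proj 1 + p.1 ^ 2 • LinearMap.proj 2
    + p.2 • (LinearMap.proj 3 + p.1 • LinearMap.proj 4)

lemma xfun_apply (p : F × F) (a : Fin 5 → F) :
    xfun p a = (a 0 + p.1 * a 1 + p.1 ^ 2 * a 2) + p.2 * (a 3 + p.1 * a 4) := by
  simp [xfun]
  ring

lemma xfun_ne (p : F × F) : xfun p ≠ 0 := by
  intro h
  have := LinearMap.congr_fun h (Pi.single 0 1)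
  simp [xfun_apply] at this

lemma proj_ne (i : Fin 5) : (LinearMap.proj i : Module.Dual F (Fin 5 → F)) ≠ 0 := by
  intro h
  have := LinearMap.congr_fun h (Pi.single i 1)
  simp at this

def dcount (a : Fin 5 → F) : ℕ :=
  #{p : F × F | xfun p a = 0} + (Fintype.card F - 1) * (if a 4 = 0 then 1 else 0)
    + Fintype.card F * (if a 2 = 0 then 1 else 0)

def onLine (z : F) (a : Fin 5 → F) : Prop := a 0 = z * a 4 ∧ a 1 = z * a 2 ∧ a 3 = a 2

instance (z : F) (a : Fin 5 → F) : Decidable (onLine z a) := by unfold onLine; infer_instance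

lemma ncount (a : Fin 5 → F) : #{p : F × F | xfun p a = 0} =
    ∑ t : F, if a 3 + t * a 4 = 0 then
      (if a 0 + t * a 1 + t ^ 2 * a 2 = 0 then Fintype.card F else 0) else 1 := by
  rw [Finset.card_filter, Fintype.sum_prod_type]
  apply Finset.sum_congr rfl
  intro t _
  rw [← Finset.card_filter]
  simp only [xfun_apply]
  split_ifs with h1 h2
  · simp [h1, h2]
  · simp [h1, h2]
  · rw [Finset.card_eq_one]
    refine ⟨-(a 0 + t * a 1 + t ^ 2 * a 2) / (a 3 + t * a 4), ?_⟩
    ext u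
    simp only [mem_filter, mem_univ, true_and, mem_singleton]
    rw [eq_div_iff h1]
    constructor
    · intro h; linear_combination h
    · intro h; linear_combination h

lemma ncount1 (a : Fin 5 → F) (h4 : a 4 ≠ 0) : 
    #{p : F × F | xfun p a = 0} = Fintype.card F - 1 +
      (if a 0 + (- a 3 / a 4) * a 1 + (- a 3 / a 4) ^ 2 * a 2 = 0 then Fintype.card F else 0) := by
  rw [ncount, ← Finset.sum_erase_add _ _ (mem_univ (- a 3 / a 4))]
  congr 1
  · rw [Finset.sum_congr rfl (g := fun _ => 1)]
    · simp [Finset.card_erase_of_mem]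
    · intro t ht
      rw [if_neg]
      intro h
      apply (Finset.mem_erase.mp ht).1
      rw [eq_div_iff h4]; linear_combination h
  · rw [if_pos]
    field_simp
    ring

lemma ncount2 (a : Fin 5 → F) (h4 : a 4 = 0) (h3 : a 3 ≠ 0) : 
    #{p : F × F | xfun p a = 0} = Fintype.card F := by
  rw [ncount]
  simp [h4, h3]

lemma ncount3 (a : Fin 5 → F) (h4 : a 4 = 0) (h3 : a 3 = 0) : 
    #{p : F × F | xfun p a = 0} =
      Fintype.card F * #{t : F | a 0 + t * a 1 + t ^ 2 * a 2 = 0} := by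
  rw [ncount, Finset.card_filter, Finset.mul_sum]
  simp [h4, h3]

lemma roots_le (x y z : F) (hz : z ≠ 0) :
    #{t : F | x + t * y + t ^ 2 * z = 0} ≤ 2 := by
  by_cases h : ∃ t1, x + t1 * y + t1 ^ 2 * z = 0
  · obtain ⟨t1, h1⟩ := h
    refine le_trans (Finset.card_le_card (t := {t1, - y / z - t1}) ?_) Finset.card_le_two
    intro t ht
    simp only [mem_filter, mem_univ, true_and, mem_insert, mem_singleton] at ht ⊢
    by_cases htt : t = t1
    · exact Or.inl htt
    · right
      have : t - t1 ≠ 0 := sub_ne_zero.mpr htt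
      have h2 : (t - t1) * (y + z * (t + t1)) = 0 := by linear_combination ht - h1
      have h3 := (mul_eq_zero.mp h2).resolve_left this
      field_simp
      linear_combination h3
  · push Not at h
    rw [Finset.card_eq_zero.mpr]
    · omega
    · ext t; simp [h t]

lemma roots_lin (x y : F) (hxy : x ≠ 0 ∨ y ≠ 0) :
    #{t : F | x + t * y = 0} ≤ 1 := by
  rw [Finset.card_le_one]
  intro s hs t ht
  simp only [mem_filter, mem_univ, true_and] at hs ht
  have h : (s - t) * y = 0 := by linear_combination hs - ht
  rcases mul_eq_zero.mp h with h | h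
  · exact sub_eq_zero.mp h
  · rw [h] at hs
    simp at hs
    simp_all

lemma dcount_mod (a : Fin 5 → F) (ha : a ≠ 0) :
    ∃ m, Fintype.card F * m + dcount a = 3 * Fintype.card F - 1 := by
  have hq : 1 ≤ Fintype.card F := Fintype.card_pos
  unfold dcount
  by_cases h4 : a 4 = 0
  · by_cases h3 : a 3 = 0
    · rw [ncount3 a h4 h3]
      by_cases h2 : a 2 = 0
      · have hr : #{t : F | a 0 + t * a 1 + t ^ 2 * a 2 = 0} ≤ 1 := by
          simp only [h2, mul_zero, add_zero]
          apply roots_lin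
          by_contra! h
          apply ha
          ext i; fin_cases i <;> simp_all
        generalize #{t : F | a 0 + t * a 1 + t ^ 2 * a 2 = 0} = r at hr
        refine ⟨1 - r, ?_⟩
        simp only [h4, h2, if_true]
        interval_cases r <;> omega
      · have hr := roots_le (a 0) (a 1) (a 2) h2
        generalize #{t : F | a 0 + t * a 1 + t ^ 2 * a 2 = 0} = r at hr
        refine ⟨2 - r, ?_⟩
        simp only [h4, h2, if_true, if_false]
        interval_cases r <;> omega
    · rw [ncount2 a h4 h3]
      by_cases h2 : a 2 = 0
      · exact ⟨0, by simp only [h4, h2, if_true]; omega⟩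
      · exact ⟨1, by simp only [h4, h2, if_true, if_false]; omega⟩
  · rw [ncount1 a h4]
    simp only [h4, if_false]
    split_ifs
    · exact ⟨0, by omega⟩
    · exact ⟨1, by omega⟩
    · exact ⟨1, by omega⟩
    · exact ⟨2, by omega⟩

lemma dcount_line (a : Fin 5 → F) (ha : a ≠ 0) (z : F) (hz : z ≠ 0) (h : onLine z a) :
    dcount a ≤ 2 * Fintype.card F - 1 := by
  have hq : 1 ≤ Fintype.card F := Fintype.card_pos
  obtain ⟨e0, e1, e3⟩ := h
  unfold dcount
  by_cases h2 : a 2 = 0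
  · have h4 : a 4 ≠ 0 := by
      intro h4
      apply ha
      ext i; fin_cases i <;> simp_all
    rw [ncount1 a h4, if_neg]
    · simp only [h4, h2, if_true, if_false]; omega
    · rw [e3, e0, e1, h2]
      simp [hz, h4]
  · by_cases h4 : a 4 = 0
    · rw [ncount2 a h4 (by rw [e3]; exact h2)]
      simp only [h4, h2, if_true, if_false]; omega
    · rw [ncount1 a h4]
      simp only [h4, h2, if_false]
      split_ifs <;> omega

def lcount (J : Finset F) (a : Fin 5 → F) : ℕ := #{z ∈ J | onLine z a}

lemma lcount_le (J : Finset F) (a : Fin 5 → F) (ha : a ≠ 0) : lcount J a ≤ 1 := by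
  unfold lcount
  rw [Finset.card_le_one]
  intro s hs t ht
  obtain ⟨-, s0, s1, s3⟩ := Finset.mem_filter.mp hs
  obtain ⟨-, t0, t1, t3⟩ := Finset.mem_filter.mp ht
  by_cases h2 : a 2 = 0
  · have h4 : a 4 ≠ 0 := by
      intro h4
      apply ha
      ext i; fin_cases i <;> simp_all
    exact mul_right_cancel₀ h4 (s0.symm.trans t0)
  · exact mul_right_cancel₀ h2 (s1.symm.trans t1)

def mult (J : Finset F) (a : Fin 5 → F) : ℕ :=
  (3 * Fintype.card F - 1 - dcount a) / Fintype.card F - lcount J a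

lemma mult_spec (J : Finset F) (hJ : 0 ∉ J) (a : Fin 5 → F) (ha : a ≠ 0) :
    Fintype.card F * mult J a + dcount a + Fintype.card F * lcount J a = 3 * Fintype.card F - 1 := by
  have hq : 1 ≤ Fintype.card F := Fintype.card_pos
  obtain ⟨m, hm⟩ := dcount_mod a ha
  have h1 : (3 * Fintype.card F - 1 - dcount a) / Fintype.card F = m := by
    rw [← hm, Nat.add_sub_cancel, Nat.mul_div_cancel_left _ hq]
  have h2 := lcount_le J a ha
  have h3 : lcount J a ≤ m := by
    rcases Nat.eq_zero_or_pos (lcount J a) with h | h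
    · omega
    · obtain ⟨z, hz⟩ := Finset.card_pos.mp h
      obtain ⟨hz, hl⟩ := Finset.mem_filter.mp hz
      have h4 := dcount_line a ha z (by rintro rfl; exact hJ hz) hl
      have : m ≠ 0 := by rintro rfl; omega
      omega
  unfold mult
  rw [h1, ← hm]
  obtain ⟨k, rfl⟩ := Nat.exists_eq_add_of_le h3
  rw [Nat.add_sub_cancel_left]
  ring

lemma mult_smul (J : Finset F) (c : F) (a : Fin 5 → F) (hc : c ≠ 0) :
    mult J (c • a) = mult J a := by
  have h1 : dcount (c • a) = dcount a := by
    unfold dcount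
    simp [hc]
  have h2 : lcount J (c • a) = lcount J a := by
    unfold lcount onLine
    congr 1
    apply Finset.filter_congr
    intro z _
    simp only [Pi.smul_apply, smul_eq_mul, mul_left_comm z c, mul_right_inj' hc]
  rw [mult, mult, h1, h2]

lemma global_count [Fintype (Projectivization F (Fin 5 → F))] (J : Finset F) (hJ : 0 ∉ J)
    (S : (Fin 5 → F) → Prop) [DecidablePred S]
    (hS0 : ¬ S 0) (hS : ∀ (c : F) (v), c ≠ 0 → (S (c • v) ↔ S v)) :
    Fintype.card F * ((Fintype.card F - 1) *
      ∑ P : Projectivization F (Fin 5 → F), if S P.rep then mult J P.rep else 0)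
    + (∑ p : F × F, #{a | S a ∧ xfun p a = 0}
      + (Fintype.card F - 1) * #{a | S a ∧ (LinearMap.proj 4 : Module.Dual F (Fin 5 → F)) a = 0}
      + Fintype.card F * #{a | S a ∧ (LinearMap.proj 2 : Module.Dual F (Fin 5 → F)) a = 0})
    + Fintype.card F * ∑ z ∈ J, #{a | S a ∧ onLine z a}
    = (3 * Fintype.card F - 1) * #{a | S a} := by
  rw [← sum_rep (fun a => if S a then mult J a else 0) (by simp [hS0])]
  · have e1 : ∑ p : F × F, #{a | S a ∧ xfun p a = 0}
        = ∑ a with S a, #{p : F × F | xfun p a = 0} := by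
      simp only [Finset.card_filter, Finset.sum_filter]
      rw [Finset.sum_comm]
      apply Finset.sum_congr rfl
      intro a _
      by_cases h : S a <;> simp [h]
    have e2 : ∑ z ∈ J, #{a | S a ∧ onLine z a} = ∑ a with S a, lcount J a := by
      unfold lcount
      simp only [Finset.card_filter, Finset.sum_filter]
      rw [Finset.sum_comm]
      apply Finset.sum_congr rfl
      intro a _
      by_cases h : S a <;> simp [h]
    have e3 : ∀ i : Fin 5, #{a | S a ∧ (LinearMap.proj i : Module.Dual F (Fin 5 → F)) a = 0}
        = ∑ a with S a, if a i = 0 then 1 else 0 := by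
      intro i
      rw [Finset.card_filter, Finset.sum_filter]
      apply Finset.sum_congr rfl
      intro a _
      by_cases h : S a <;> simp [h]
    rw [e1, e2, e3, e3, ← Finset.sum_filter]
    simp only [Finset.mul_sum, ← Finset.sum_add_distrib]
    rw [mul_comm, ← smul_eq_mul, ← Finset.sum_const]
    apply Finset.sum_congr rfl
    intro a ha
    have hSa := (Finset.mem_filter.mp ha).2
    exact mult_spec J hJ a (by rintro rfl; exact hS0 hSa)
  · intro c v hc
    simp only [hS c v hc, mult_smul J c v hc]

/-- parametrisation of a line -/
def lpar (z : F) : F × F →ₗ[F] (Fin 5 → F) where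
  toFun p := ![z * p.1, z * p.2, p.2, p.2, p.1]
  map_add' p q := by ext i; fin_cases i <;> simp [mul_add]
  map_smul' c p := by ext i; fin_cases i <;> simp [mul_left_comm]

lemma line_card (z : F) (S : (Fin 5 → F) → Prop) [DecidablePred S] :
    #{a | S a ∧ onLine z a} = #{p : F × F | S (lpar z p)} := by
  symm
  apply Finset.card_bij (fun p _ => lpar z p)
  · intro p hp
    simp only [mem_filter, mem_univ, true_and] at hp ⊢
    refine ⟨hp, ?_, ?_, ?_⟩ <;> simp [lpar]
  · intro p _ p' _ h
    have h1 := congrFun h 4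
    have h2 := congrFun h 2
    simp [lpar] at h1 h2
    exact Prod.ext h1 h2
  · intro a ha
    simp only [mem_filter, mem_univ, true_and] at ha
    obtain ⟨hs, h0, h1, h3⟩ := ha
    have : lpar z (a 4, a 2) = a := by
      ext i; fin_cases i <;> simp [lpar, h0, h1, h3]
    exact ⟨(a 4, a 2), by simp [this, hs], this⟩

end geom

section final
open Finset
variable {F : Type} [Field F] [Fintype F] [DecidableEq F]

lemma zero_card (x : Module.Dual F (Fin 5 → F)) (hx : x ≠ 0) :
    #{a : Fin 5 → F | a ≠ 0 ∧ x a = 0} + 1 = Fintype.card F ^ 4 := by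
  have h := card_zero_mul x hx
  have hq : 0 < Fintype.card F := Fintype.card_pos
  have h1 : #{v : Fin 5 → F | x v = 0} = Fintype.card F ^ 4 := by
    apply Nat.eq_of_mul_eq_mul_right hq
    rw [h]; simp; ring
  have h0 : (0 : Fin 5 → F) ∈ ({v : Fin 5 → F | x v = 0} : Finset _) := by simp
  rw [← h1, ← Finset.card_erase_add_one h0]
  congr 2
  ext a
  simp

lemma ne_card (b x : Module.Dual F (Fin 5 → F)) (hx : x ≠ 0) :
    #{a : Fin 5 → F | b a ≠ 0 ∧ x a = 0} ≤ Fintype.card F ^ 3 * (Fintype.card F - 1) := by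
  have h := card_ne_and_mul b x hx
  have hq : 0 < Fintype.card F := Fintype.card_pos
  apply Nat.le_of_mul_le_mul_right (c := Fintype.card F ^ 2) _ (by positivity)
  refine h.trans (le_of_eq ?_)
  simp; ring

lemma line_zero (z : F) : #{a : Fin 5 → F | a ≠ 0 ∧ onLine z a} + 1 = Fintype.card F ^ 2 := by
  rw [line_card z (fun a => a ≠ 0)]
  have h1 : Fintype.card (F × F) = Fintype.card F ^ 2 := by simp; ring
  rw [← h1, ← Finset.card_univ, ← Finset.card_erase_add_one (mem_univ (0 : F × F))]
  congr 2
  ext p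
  simp only [mem_filter, mem_univ, true_and, mem_erase, and_true]
  rw [not_iff_not]
  constructor
  · intro h
    have h1 := congrFun h 4
    have h2 := congrFun h 2
    simp [lpar] at h1 h2
    exact Prod.ext h1 h2
  · rintro rfl; simp

lemma line_ne (z : F) (b : Module.Dual F (Fin 5 → F)) :
    #{a : Fin 5 → F | b a ≠ 0 ∧ onLine z a} ≤ Fintype.card F * (Fintype.card F - 1) := by
  rw [line_card z (fun a => b a ≠ 0)]
  have h := card_ne_mul (b.comp (lpar z))
  have hq : 0 < Fintype.card F := Fintype.card_pos
  apply Nat.le_of_mul_le_mul_right (c := Fintype.card F) _ hq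
  refine h.trans (le_of_eq ?_)
  simp; ring

lemma ne_total (b : Module.Dual F (Fin 5 → F)) (hb : b ≠ 0) :
    #{a : Fin 5 → F | b a ≠ 0} = Fintype.card F ^ 4 * (Fintype.card F - 1) := by
  have h := card_zero_mul b hb
  have hq : 0 < Fintype.card F := Fintype.card_pos
  have h1 : #{v : Fin 5 → F | b v = 0} = Fintype.card F ^ 4 := by
    apply Nat.eq_of_mul_eq_mul_right hq
    rw [h]; simp; ring
  have h2 := Finset.card_filter_add_card_filter_not (s := (univ : Finset (Fin 5 → F)))
    (fun v => b v = 0)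
  rw [card_univ, h1] at h2
  have h3 : Fintype.card (Fin 5 → F) = Fintype.card F ^ 5 := by simp
  rw [h3] at h2
  obtain ⟨r, hr⟩ : ∃ r, Fintype.card F = r + 1 := ⟨Fintype.card F - 1, by omega⟩
  have h4 : #{a : Fin 5 → F | b a ≠ 0} = #{a : Fin 5 → F | ¬ b a = 0} := rfl
  rw [h4]
  rw [hr] at h2 ⊢
  rw [Nat.add_sub_cancel]
  have : (r + 1) ^ 5 = (r + 1) ^ 4 + (r + 1) ^ 4 * r := by ring
  omega

lemma ne_zero_total :
    #{a : Fin 5 → F | a ≠ 0} + 1 = Fintype.card F ^ 5 := by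
  have h3 : Fintype.card (Fin 5 → F) = Fintype.card F ^ 5 := by simp
  rw [← h3, ← Finset.card_univ, ← Finset.card_erase_add_one (mem_univ (0 : Fin 5 → F))]
  congr 2
  ext p
  simp

lemma family [Fintype (Projectivization F (Fin 5 → F))] (hq3 : 3 ≤ Fintype.card F)
    (J : Finset F) (hJ : 0 ∉ J) :
    ((∑ P : Projectivization F (Fin 5 → F), mult J P.rep : ℕ) : ℤ)
      = 2 * (Fintype.card F : ℤ) ^ 4 - (Fintype.card F : ℤ) ^ 3 + 1
        - #J * ((Fintype.card F : ℤ) + 1) ∧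
    ∀ b : Module.Dual F (Fin 5 → F), b ≠ 0 →
      2 * (Fintype.card F : ℤ) ^ 4 - 3 * (Fintype.card F : ℤ) ^ 3 + (Fintype.card F : ℤ) ^ 2
        - #J * (Fintype.card F : ℤ) ≤
      ((∑ P : Projectivization F (Fin 5 → F), if b P.rep ≠ 0 then mult J P.rep else 0 : ℕ) : ℤ)
      := by
  obtain ⟨r, hr⟩ : ∃ r, Fintype.card F = r + 1 := ⟨Fintype.card F - 1, by omega⟩
  have hr2 : (2 : ℤ) ≤ r := by exact_mod_cast (by omega : 2 ≤ r)
  constructor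
  · have h := global_count J hJ (fun a => a ≠ 0) (by simp) (by
      intro c v hc; simp [hc])
    have e0 := ne_zero_total (F := F)
    have e1 : ∀ p ∈ (univ : Finset (F × F)), #{a : Fin 5 → F | a ≠ 0 ∧ xfun p a = 0}
        = Fintype.card F ^ 4 - 1 := fun p _ => by
      have := zero_card (xfun p) (xfun_ne p); omega
    have e2 := zero_card _ (proj_ne (F := F) 4)
    have e3 := zero_card _ (proj_ne (F := F) 2)
    have e4 : ∀ z ∈ J, #{a : Fin 5 → F | a ≠ 0 ∧ onLine z a}
        = Fintype.card F ^ 2 - 1 := fun z _ => by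
      have := line_zero z; omega
    rw [Finset.sum_congr rfl e1, Finset.sum_congr rfl e4, Finset.sum_const, Finset.sum_const,
      Finset.card_univ, Fintype.card_prod] at h
    simp only [ne_eq, Projectivization.rep_nonzero, not_false_eq_true, if_true, smul_eq_mul] at h e0 e2 e3
    generalize (∑ P : Projectivization F (Fin 5 → F), mult J P.rep) = N at *
    generalize #{a : Fin 5 → F | ¬ a = 0 ∧ (LinearMap.proj 4 : Module.Dual F (Fin 5 → F)) a = 0} = A at *
    generalize #{a : Fin 5 → F | ¬ a = 0 ∧ (LinearMap.proj 2 : Module.Dual F (Fin 5 → F)) a = 0} = B at *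
    generalize #{a : Fin 5 → F | ¬ a = 0} = T at *
    generalize #J = j at *
    rw [hr] at *
    obtain ⟨A4, hA4⟩ : ∃ A4, (r + 1) ^ 4 = A4 + 1 := ⟨A, e2.symm⟩
    obtain ⟨A2, hA2⟩ : ∃ A2, (r + 1) ^ 2 = A2 + 1 := ⟨r * (r + 2), by ring⟩
    have hA : A = A4 := by omega
    have hB : B = A4 := by omega
    have e5 : 3 * (r + 1) - 1 = 3 * r + 2 := by omega
    rw [hA4, hA2, hA, hB, e5] at h
    simp only [Nat.add_sub_cancel] at h
    zify at h hA4 hA2 e0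
    have hT : (T : ℤ) = (r + 1) ^ 5 - 1 := by linarith
    have hA4' : (A4 : ℤ) = (r + 1) ^ 4 - 1 := by linarith
    have hA2' : (A2 : ℤ) = (r + 1) ^ 2 - 1 := by linarith
    rw [hT, hA4', hA2'] at h
    have hpos : ((r : ℤ) + 1) * r ≠ 0 := by positivity
    apply mul_left_cancel₀ hpos
    push_cast
    linear_combination h
  · intro b hb
    have h := global_count J hJ (fun a => b a ≠ 0) (by simp) (by
      intro c v hc; simp [hc])
    have e0 := ne_total b hb
    have e1 := Finset.sum_le_sum (fun p (_ : p ∈ (univ : Finset (F × F))) =>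
      ne_card b (xfun p) (xfun_ne p))
    have e2 := ne_card b _ (proj_ne (F := F) 4)
    have e3 := ne_card b _ (proj_ne (F := F) 2)
    have e4 := Finset.sum_le_sum (fun z (_ : z ∈ J) => line_ne z b)
    rw [Finset.sum_const, smul_eq_mul, Finset.card_univ, Fintype.card_prod] at e1
    rw [Finset.sum_const, smul_eq_mul] at e4
    generalize (∑ P : Projectivization F (Fin 5 → F), if b P.rep ≠ 0 then mult J P.rep else 0)
      = N at *
    generalize #{a : Fin 5 → F | b a ≠ 0 ∧ (LinearMap.proj 4 : Module.Dual F (Fin 5 → F)) a = 0} = A at *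
    generalize #{a : Fin 5 → F | b a ≠ 0 ∧ (LinearMap.proj 2 : Module.Dual F (Fin 5 → F)) a = 0} = B at *
    generalize #{a : Fin 5 → F | b a ≠ 0} = T at *
    generalize ∑ p : F × F, #{a : Fin 5 → F | b a ≠ 0 ∧ xfun p a = 0} = X at *
    generalize ∑ z ∈ J, #{a : Fin 5 → F | b a ≠ 0 ∧ onLine z a} = Y at *
    generalize #J = j at *
    rw [hr] at *
    have e5 : 3 * (r + 1) - 1 = 3 * r + 2 := by omega
    rw [e5, e0] at h
    simp only [Nat.add_sub_cancel] at *
    zify at h e1 e2 e3 e4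
    have hpos : 0 < ((r : ℤ) + 1) * r := by positivity
    apply le_of_mul_le_mul_left _ hpos
    push_cast
    have f2 := mul_le_mul_of_nonneg_left e2 (by positivity : (0 : ℤ) ≤ r)
    have f3 := mul_le_mul_of_nonneg_left e3 (by positivity : (0 : ℤ) ≤ r + 1)
    have f4 := mul_le_mul_of_nonneg_left e4 (by positivity : (0 : ℤ) ≤ r + 1)
    linarith

lemma griesmer_eq (q j r d : ℕ) (hq : 3 ≤ q) (hr : r < q) (hjr : j * q + r + q ≤ q ^ 2)
    (hd : (d : ℤ) = 2 * (q : ℤ) ^ 4 - 3 * (q : ℤ) ^ 3 + (q : ℤ) ^ 2 - j * q - r) :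
    (griesmer q 5 d : ℤ) = 2 * (q : ℤ) ^ 4 - (q : ℤ) ^ 3 + 1 - j * (q + 1) - r := by
  have ceil : ∀ (i : ℕ) (c : ℤ), ((q : ℤ) ^ i * (c - 1) < d) → ((d : ℤ) ≤ q ^ i * c) →
      (((d + q ^ i - 1) / q ^ i : ℕ) : ℤ) = c := by
    intro i c h1 h2
    have hp : (0 : ℤ) < (q : ℤ) ^ i := by positivity
    have hp' : 1 ≤ q ^ i := Nat.one_le_pow _ _ (by omega)
    rw [Int.natCast_ediv, Nat.cast_sub (by omega)]
    push_cast
    apply le_antisymm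
    · apply Int.le_of_lt_add_one
      apply Int.ediv_lt_of_lt_mul hp
      linarith
    · apply Int.le_ediv_of_mul_le hp
      linarith
  have hq' : (3 : ℤ) ≤ q := by exact_mod_cast hq
  have hr' : (r : ℤ) < q := by exact_mod_cast hr
  have hjr' : (j : ℤ) * q + r + q ≤ q ^ 2 := by exact_mod_cast hjr
  have hjp : (0 : ℤ) ≤ (j : ℤ) * q := by positivity
  have hrp : (0 : ℤ) ≤ r := by positivity
  have hq23 : (q : ℤ) ^ 2 ≤ (q : ℤ) ^ 3 := by nlinarith [sq_nonneg (q : ℤ)]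
  have hq34 : 3 * (q : ℤ) ^ 3 ≤ (q : ℤ) ^ 4 := by
    have : (0 : ℤ) ≤ (q : ℤ) ^ 3 := by positivity
    nlinarith
  have c0 := ceil 0 d (by simp) (by simp)
  have c1 := ceil 1 (2 * q ^ 3 - 3 * q ^ 2 + q - j) (by linarith) (by linarith)
  have c2 := ceil 2 (2 * q ^ 2 - 3 * q + 1) (by linarith) (by linarith)
  have c3 := ceil 3 (2 * q - 2) (by linarith) (by linarith)
  have c4 := ceil 4 2 (by linarith) (by linarith)
  unfold griesmer
  simp only [Finset.sum_range_succ, Finset.sum_range_zero, zero_add]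
  rw [Nat.cast_add, Nat.cast_add, Nat.cast_add, Nat.cast_add, c0, c1, c2, c3, c4, hd]
  ring

end final

/-- For every prime power `q ≥ 3` and every `d` with
`2q⁴ - 3q³ + q ≤ d ≤ 2q⁴ - 3q³ + q²` there exists a `[g_q(5,d), 5, d]_q` code. -/
theorem statement2 (q d : ℕ) (hq : IsPrimePow q) (hq3 : 3 ≤ q)
    (hd1 : 2 * (q : ℤ) ^ 4 - 3 * (q : ℤ) ^ 3 + (q : ℤ) ≤ (d : ℤ))
    (hd2 : (d : ℤ) ≤ 2 * (q : ℤ) ^ 4 - 3 * (q : ℤ) ^ 3 + (q : ℤ) ^ 2)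
    (F : Type) [Field F] [Fintype F] [DecidableEq F] (hF : Fintype.card F = q) :
    ∃ C : Submodule F (Fin (griesmer q 5 d) → F),
      IsLinearCodeWith F (griesmer q 5 d) 5 d C := by
  classical
  have : Fintype (Projectivization F (Fin 5 → F)) := Fintype.ofFinite _
  have hqq : q ≤ q ^ 2 := by nlinarith
  obtain ⟨e, he⟩ : ∃ e : ℕ, (e : ℤ) = 2 * (q : ℤ) ^ 4 - 3 * (q : ℤ) ^ 3 + (q : ℤ) ^ 2 - d :=
    ⟨(2 * (q : ℤ) ^ 4 - 3 * (q : ℤ) ^ 3 + (q : ℤ) ^ 2 - d).toNat, Int.toNat_of_nonneg (by linarith)⟩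
  have he2 : e + q ≤ q ^ 2 := by zify; linarith
  set j := e / q with hj
  set r := e % q with hr
  have hrq : r < q := Nat.mod_lt _ (by omega)
  have hjr : j * q + r = e := by rw [mul_comm]; exact Nat.div_add_mod e q
  have hjq : j ≤ q - 1 := by
    have h1 : (j + 1) * q ≤ q * q := by nlinarith
    have := Nat.le_of_mul_le_mul_right h1 (by omega)
    omega
  have hdd : (d : ℤ) = 2 * (q : ℤ) ^ 4 - 3 * (q : ℤ) ^ 3 + (q : ℤ) ^ 2 - j * q - r := by
    have : (j : ℤ) * q + r = e := by exact_mod_cast hjr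
    linarith
  have hg := griesmer_eq q j r d hq3 hrq (by omega) hdd
  have hd1' : 1 ≤ d := by
    have : (0 : ℤ) < d := by
      have h0 : (0 : ℤ) ≤ (q : ℤ) ^ 3 := by positivity
      have h3 : (3 : ℤ) ≤ q := by exact_mod_cast hq3
      nlinarith
    exact_mod_cast this
  obtain ⟨J, hJs, hJc⟩ := Finset.exists_subset_card_eq (s := Finset.univ.erase (0 : F)) (n := j)
    (by rw [Finset.card_erase_of_mem (Finset.mem_univ _), Finset.card_univ, hF]; exact hjq)
  have hJ0 : (0 : F) ∉ J := fun h => by simpa using hJs h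
  obtain ⟨hN, hW⟩ := family (by omega) J hJ0
  rw [hJc, hF] at hN
  simp only [hJc, hF] at hW
  let ι := Σ P : Projectivization F (Fin 5 → F), Fin (mult J P.rep)
  have hcard : Fintype.card ι = ∑ P : Projectivization F (Fin 5 → F), mult J P.rep := by
    simp [ι]
  rw [← hcard] at hN
  have hn : griesmer q 5 d + r = Fintype.card ι := by
    zify; linarith
  generalize griesmer q 5 d = n at *
  let emb : Fin n → ι := fun i => (Fintype.equivFin ι).symm (Fin.castLE (by omega) i)
  have hemb : Function.Injective emb :=
    (Fintype.equivFin ι).symm.injective.comp (Fin.castLE_injective _)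
  apply exact_code n d hd1' (fun i => (emb i).1.rep)
  intro b hb
  have h1 := hW b hb
  have h2 : (Finset.univ.filter (fun i : ι => b i.1.rep ≠ 0)).card =
      ∑ P : Projectivization F (Fin 5 → F), if b P.rep ≠ 0 then mult J P.rep else 0 := by
    rw [Finset.card_filter, Fintype.sum_sigma]
    apply Finset.sum_congr rfl
    intro P _
    by_cases h : b P.rep = 0 <;> simp [h]
  rw [← h2] at h1
  have h3 : (Finset.univ.filter (fun i : ι => b i.1.rep ≠ 0)).card ≤
      hammingNorm (fun i => b ((emb i).1.rep)) + r := by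
    have h4 : hammingNorm (fun i => b ((emb i).1.rep)) =
        ((Finset.univ.filter (fun i : Fin n => b (emb i).1.rep ≠ 0)).image emb).card := by
      rw [Finset.card_image_of_injective _ hemb]; rfl
    have h5 : ((Finset.univ.image emb)ᶜ : Finset ι).card = r := by
      rw [Finset.card_compl, Finset.card_image_of_injective _ hemb]
      simp only [Finset.card_univ, Fintype.card_fin]
      omega
    rw [h4, ← h5]
    refine le_trans (Finset.card_le_card ?_) (Finset.card_union_le _ _)
    intro i hi
    simp only [Finset.mem_filter, Finset.mem_univ, true_and] at hi
    rw [Finset.mem_union]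
    by_cases hi2 : i ∈ Finset.univ.image emb
    · left
      obtain ⟨k, -, rfl⟩ := Finset.mem_image.mp hi2
      exact Finset.mem_image.mpr ⟨k, by simpa using hi, rfl⟩
    · right
      exact Finset.mem_compl.mpr hi2
  zify at h3 ⊢
  linarith
end
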